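/- arXiv:1602.01233 — 6 statements merged into one kernel-verified Lean document; each statement's English description precedes it below -/
import Mathlib

section
/- Let $(K,v)$ be a henselian nontrivially valued field, $E \subseteq K$ a subfield, and $b \in K$ separably algebraic over $E$. Suppose $(K,v)$ is $|E|^+$-saturated. Then there exists $b' \in K$ transcendental over $E$ such that $b$ lies in the henselization $E(b')^h$ of $E(b')$ with respect to $v$ inside $K$. -/
open FirstOrder Language

/-- The language with a single unary relation symbol. -/
def predLang : Language :=
  ⟨fun _ => Empty, fun n => match n with | 1 => PUnit | _ => Empty⟩

/-- The one-sorted language of valued fields: the language of rings together with a unary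
predicate for the valuation ring. -/
def valLang : Language := Language.ring.sum predLang

/-- The valued-field structure on `K` induced by a valuation ring `O`. -/
noncomputable def valStructure (K : Type*) [Field K] (O : ValuationSubring K) :
    valLang.Structure K :=
  letI := Ring.compatibleRingOfRing K
  letI : predLang.Structure K :=
    { funMap := fun {n} f _ => f.elim
      RelMap := fun {n} r x =>
        match n, r, x with
        | 0, r, _ => r.elim
        | 1, _, x => x 0 ∈ O
        | _ + 2, r, _ => r.elim }
  Language.sumStructure _ _ K

/-- A structure is `κ`-saturated: every finitely satisfiable set of formulas in one free
variable with fewer than `κ` parameters is realized. -/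
def IsSaturatedIn (L : Language) (M : Type*) [L.Structure M] (κ : Cardinal) : Prop :=
  ∀ A : Set M, Cardinal.mk A < κ →
    ∀ S : Set ((L[[A]]).Formula (Fin 1)),
      (∀ t : Finset ((L[[A]]).Formula (Fin 1)), ↑t ⊆ S →
        ∃ x : M, ∀ φ ∈ t, Formula.Realize φ (fun _ => x)) →
      ∃ x : M, ∀ φ ∈ S, Formula.Realize φ (fun _ => x)

open Polynomial in
/-- Hensel's lemma for the reciprocal of the Newton polynomial. -/
theorem HenselianLocalRing.exists_root_pow_mul_add_one {R : Type*} [CommRing R]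
    [HenselianLocalRing R] (k : ℕ) (c : ℕ → R)
    (hc : ∀ i < k, c i ∈ IsLocalRing.maximalIdeal R) :
    ∃ y : R, IsUnit y ∧
      y ^ k * (y + 1) + ∑ i ∈ Finset.range k, c i * y ^ (k - 1 - i) = 0 := by
  set r : R[X] := ∑ i ∈ Finset.range k, C (c i) * X ^ (k - 1 - i) with hr
  have hrdeg : r.degree < ((k + 1 : ℕ) : WithBot ℕ) := by
    refine (degree_sum_le _ _).trans_lt ((Finset.sup_lt_iff (WithBot.bot_lt_coe _)).2 ?_)
    intro i hi
    refine (degree_C_mul_X_pow_le _ _).trans_lt ?_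
    have := Finset.mem_range.1 hi
    exact_mod_cast (by omega : k - 1 - i < k + 1)
  have hmonic : (X ^ k * (X + C 1) + r).Monic := by
    refine Monic.add_of_left ((monic_X_pow k).mul (monic_X_add_C 1)) ?_
    rcases subsingleton_or_nontrivial R with h | h
    · exact absurd h (not_subsingleton R)
    rw [(monic_X_add_C 1).degree_mul, degree_X_pow, degree_X_add_C]
    exact_mod_cast hrdeg
  have hreval : ∀ x : R, r.eval x ∈ IsLocalRing.maximalIdeal R := fun x ↦ by
    rw [hr, eval_finsetSum]
    refine Ideal.sum_mem _ fun i hi ↦ ?_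
    simpa using Ideal.mul_mem_right _ _ (hc i (Finset.mem_range.1 hi))
  have hrder : ∀ x : R, r.derivative.eval x ∈ IsLocalRing.maximalIdeal R := fun x ↦ by
    rw [hr, derivative_sum, eval_finsetSum]
    refine Ideal.sum_mem _ fun i hi ↦ ?_
    rw [derivative_C_mul, eval_mul, eval_C]
    exact Ideal.mul_mem_right _ _ (hc i (Finset.mem_range.1 hi))
  obtain ⟨y, hy, hy1⟩ := HenselianLocalRing.is_henselian _ hmonic (-1) (by
    simpa using hreval (-1)) (by
    have h1 : (X ^ k * (X + C 1) + r).derivative.eval (-1) = (-1) ^ k + r.derivative.eval (-1) := by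
      simp [derivative_mul]
    rw [h1]
    by_contra hcon
    have h2 := (IsLocalRing.mem_maximalIdeal _).2 hcon
    have h3 := (Ideal.add_mem_iff_left _ (hrder (-1))).1 h2
    exact (IsLocalRing.mem_maximalIdeal _).1 h3 (isUnit_one.neg.pow k))
  refine ⟨y, ?_, by simpa [hr, IsRoot, eval_finsetSum] using hy⟩
  by_contra hcon
  have h2 := (IsLocalRing.mem_maximalIdeal _).2 hcon
  rw [sub_neg_eq_add] at hy1
  have h3 := (Ideal.add_mem_iff_right _ h2).1 hy1
  exact (IsLocalRing.mem_maximalIdeal _).1 h3 isUnit_one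

open Polynomial in
/-- Newton approximation: if the Taylor coefficients of `f` at `a` are dominated by the first two,
then `f` has a root whose distance to `a` is `f(a)/f'(a)` up to a unit. -/
theorem ValuationSubring.exists_isRoot_of_newton {L : Type*} [Field L] (R : ValuationSubring L)
    [HenselianLocalRing R] (f : L[X]) (a : L) (h0 : f.eval a ≠ 0)
    (h1 : f.derivative.eval a ≠ 0)
    (hc : ∀ i, (hasseDeriv (i + 2) f).eval a * f.eval a ^ (i + 1) /
      f.derivative.eval a ^ (i + 2) ∈ R.nonunits) :
    ∃ y : R, IsUnit y ∧ f.IsRoot (a + f.eval a / (f.derivative.eval a * y)) := by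
  obtain ⟨y, hy, hroot⟩ := HenselianLocalRing.exists_root_pow_mul_add_one (f.natDegree)
    (fun i ↦ (⟨_, R.nonunits_le (hc i)⟩ : R))
    (fun i _ ↦ R.coe_mem_nonunits_iff.1 (hc i))
  refine ⟨y, hy, ?_⟩
  have hy0 : (y : L) ≠ 0 := fun h ↦ hy.ne_zero (Subtype.ext h)
  set k := f.natDegree
  set δ := f.eval a / (f.derivative.eval a * y) with hδ
  have hroot' := congrArg (Subtype.val : R → L) hroot
  push_cast at hroot'
  have htay : f.eval (a + δ) = ∑ i ∈ Finset.range (k + 2), (taylor a f).coeff i * δ ^ i := by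
    rw [add_comm, ← taylor_eval, eval_eq_sum_range' (n := k + 2)]
    rw [natDegree_taylor]; omega
  rw [IsRoot, htay, Finset.sum_range_succ', Finset.sum_range_succ']
  simp only [taylor_coeff, hasseDeriv_zero', zero_add, hasseDeriv_one']
  have hmul : y ^ (k + 1) *
      ((∑ i ∈ Finset.range k, (hasseDeriv (i + 1 + 1) f).eval a * δ ^ (i + 1 + 1)) +
      f.derivative.eval a * δ ^ 1 + f.eval a * δ ^ 0) = f.eval a * 0 := by
    rw [← hroot', mul_add, mul_add, mul_add, Finset.mul_sum, Finset.mul_sum, add_assoc, add_comm]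
    congr 1
    · rw [hδ]; field_simp; ring
    · refine Finset.sum_congr rfl fun i hi ↦ ?_
      have := Finset.mem_range.1 hi
      obtain ⟨j, hj⟩ : ∃ j, k = i + 1 + j := ⟨k - i - 1, by omega⟩
      rw [hj, show i + 1 + j - 1 - i = j by omega, hδ]
      simp only [div_pow, mul_pow, pow_add, pow_one]
      field_simp
  exact (mul_eq_zero.1 (hmul.trans (mul_zero _))).resolve_left (pow_ne_zero _ hy0)

/-- In the valuation topology, every neighbourhood of a point contains a disc of nonzero radius. -/
theorem ValuationSubring.exists_forall_add_mul_of_eventually {K : Type*} [Field K]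
    (O : ValuationSubring K) (hnt : O ≠ ⊤) (b : K) {p : K → Prop}
    (hp : letI := Valued.mk' O.valuation; ∀ᶠ x in nhds b, p x) :
    ∃ d : K, d ≠ 0 ∧ ∀ s ∈ O, p (b + d * s) := by
  let := Valued.mk' O.valuation
  obtain ⟨γ, hγ⟩ := Valued.mem_nhds.1 hp
  obtain ⟨t, ht⟩ : ∃ t, t ∉ O := by
    by_contra! h
    exact hnt (_root_.eq_top_iff.2 fun x _ ↦ h x)
  have ht0 : t ≠ 0 := fun h ↦ ht (h ▸ O.zero_mem)
  obtain ⟨x, hx⟩ := O.valuation_surjective (MonoidWithZeroHom.ValueGroup₀.embedding γ.1)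
  have hx0 : x ≠ 0 := by
    rintro rfl
    simp at hx
    exact absurd hx.symm (by simp)
  refine ⟨x / t, div_ne_zero hx0 ht0, fun s hs ↦ hγ ?_⟩
  rw [Set.mem_ofPred_eq, Valuation.restrict_lt_iff_lt_embedding, add_sub_cancel_left]
  change O.valuation _ < _
  rw [← hx, map_mul, map_div₀]
  have hxv : 0 < O.valuation x := by simpa [zero_lt_iff] using hx0
  have htv : 1 < O.valuation t := not_le.1 fun h ↦ ht ((O.valuation_le_one_iff t).1 h)
  calc _ ≤ O.valuation x / O.valuation t * 1 := by
        gcongr; exact (O.valuation_le_one_iff s).2 hs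
    _ < O.valuation x := by
        rw [mul_one]
        exact (div_lt_iff₀ (zero_lt_one.trans htv)).2 (lt_mul_of_one_lt_right hxv htv)

open Polynomial Topology in
/-- On a small disc around a simple root `b` of `f` the Newton smallness conditions hold, and the
only root of `f` obtained by a Newton correction is `b`. -/
theorem ValuationSubring.exists_disc_newton {K : Type*} [Field K]
    (O : ValuationSubring K) (hnt : O ≠ ⊤) (f : K[X]) (b : K) (hb : f.IsRoot b)
    (hb' : f.derivative.eval b ≠ 0) :
    ∃ d : K, d ≠ 0 ∧ ∀ s ∈ O, f.derivative.eval (b + d * s) ≠ 0 ∧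
      (∀ i, (hasseDeriv (i + 2) f).eval (b + d * s) * f.eval (b + d * s) ^ (i + 1) /
        f.derivative.eval (b + d * s) ^ (i + 2) ∈ O.nonunits) ∧
      ∀ u ∈ O, f.IsRoot (b + d * s + f.eval (b + d * s) / f.derivative.eval (b + d * s) * u) →
        b + d * s + f.eval (b + d * s) / f.derivative.eval (b + d * s) * u = b := by
  let := Valued.mk' O.valuation
  have hf0 : f ≠ 0 := by rintro rfl; simp at hb'
  have hsmall : ∀ g : K → K, ContinuousAt g b → g b = 0 → ∀ γ, γ ≠ 0 →
      ∀ᶠ x in 𝓝 b, O.valuation (g x) < O.valuation γ := by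
    intro g hg hgb γ hγ
    have hO : {x | O.valuation x < O.valuation γ} ∈ 𝓝 (0 : K) := by
      refine Valued.mem_nhds_zero.2
        ⟨Units.mk0 (O.valuation.restrict γ) (by simpa using hγ), fun x hx ↦ ?_⟩
      exact O.valuation.restrict_lt_iff.1 hx
    rw [← hgb] at hO
    exact hg hO
  obtain ⟨γ, hγ0, hγ⟩ : ∃ γ : K, γ ≠ 0 ∧ ∀ s ∈ O, f.IsRoot (b + γ * s) → b + γ * s = b := by
    refine O.exists_forall_add_mul_of_eventually hnt b (p := fun x ↦ f.IsRoot x → x = b) ?_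
    have hfin : ({x | f.IsRoot x} \ {b}).Finite :=
      ((f.finite_setOfPred_isRoot hf0)).subset Set.sdiff_subset
    filter_upwards [hfin.isClosed.isOpen_compl.mem_nhds (x := b) (by simp)] with x hx hxr
    by_contra hne
    exact hx ⟨hxr, hne⟩
  have hcont : ContinuousAt (fun x ↦ f.eval x / f.derivative.eval x) b :=
    f.continuous.continuousAt.div f.derivative.continuous.continuousAt hb'
  refine O.exists_forall_add_mul_of_eventually hnt b (p := fun x ↦ f.derivative.eval x ≠ 0 ∧
    (∀ i, (hasseDeriv (i + 2) f).eval x * f.eval x ^ (i + 1) /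
      f.derivative.eval x ^ (i + 2) ∈ O.nonunits) ∧
    ∀ u ∈ O, f.IsRoot (x + f.eval x / f.derivative.eval x * u) →
      x + f.eval x / f.derivative.eval x * u = b) ?_
  have hcoeff : ∀ᶠ x in 𝓝 b, ∀ i ∈ Finset.range f.natDegree,
      (hasseDeriv (i + 2) f).eval x * f.eval x ^ (i + 1) /
        f.derivative.eval x ^ (i + 2) ∈ O.nonunits := by
    rw [Filter.eventually_all_finset]
    intro i _
    have := hsmall (fun x ↦ (hasseDeriv (i + 2) f).eval x * f.eval x ^ (i + 1) /
        f.derivative.eval x ^ (i + 2))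
      (((hasseDeriv (i + 2) f).continuous.mul (f.continuous.pow _)).continuousAt.div
        (f.derivative.continuous.pow _).continuousAt (pow_ne_zero _ hb'))
      (by simp [hb.eq_zero]) 1 one_ne_zero
    filter_upwards [this] with x hx
    rw [mem_nonunits_iff]
    simpa using hx
  filter_upwards [f.derivative.continuous.continuousAt.eventually_ne hb', hcoeff,
    hsmall _ hcont (by simp [hb.eq_zero]) γ hγ0,
    hsmall (fun x ↦ x - b) (by fun_prop) (sub_self b) γ hγ0] with x hx1 hx2 hx3 hx4
  refine ⟨hx1, fun i ↦ ?_, fun u hu hroot ↦ ?_⟩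
  · rcases lt_or_ge i f.natDegree with h | h
    · exact hx2 i (Finset.mem_range.2 h)
    · rw [hasseDeriv_eq_zero_of_lt_natDegree f (i + 2) (by omega)]
      simp
  · have key : x + f.eval x / f.derivative.eval x * u =
        b + γ * ((x - b + f.eval x / f.derivative.eval x * u) / γ) := by
      field_simp
      ring
    rw [key] at hroot ⊢
    refine hγ _ ?_ hroot
    rw [← O.valuation_le_one_iff, map_div₀]
    refine div_le_one_of_le₀ (O.valuation.map_add_le hx4.le ?_) zero_le
    rw [map_mul]
    exact (mul_le_of_le_one_right' ((O.valuation_le_one_iff u).2 hu)).trans hx3.le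

open Polynomial in
/-- Variant of `ValuationSubring.exists_isRoot_of_newton` for a henselian subfield, with the
smallness conditions expressed in the ambient field. -/
theorem ValuationSubring.exists_isRoot_of_newton_subfield {K : Type*} [Field K]
    (O : ValuationSubring K) (M : Subfield K) (hM : HenselianLocalRing ↥(O.comap M.subtype))
    (g : M[X]) (f : K[X]) (hf : f = g.map M.subtype) (a : K) (ha : a ∈ M)
    (h0 : f.eval a ≠ 0) (h1 : f.derivative.eval a ≠ 0)
    (hc : ∀ i, (hasseDeriv (i + 2) f).eval a * f.eval a ^ (i + 1) /
      f.derivative.eval a ^ (i + 2) ∈ O.nonunits) :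
    ∃ u ∈ O, f.IsRoot (a + f.eval a / f.derivative.eval a * u) ∧
      a + f.eval a / f.derivative.eval a * u ∈ M := by
  subst hf
  lift a to M using ha
  have hev : ∀ (p : M[X]) (x : M), (p.map M.subtype).eval (x : K) = (p.eval x : M) := fun p x ↦ by
    exact (eval_map _ _).trans (eval₂_at_apply _ _)
  have hha : ∀ n, (hasseDeriv n (g.map M.subtype)).eval (a : K) = ((hasseDeriv n g).eval a : M) := by
    intro n
    rw [← taylor_coeff, ← taylor_coeff]
    exact (congrArg (fun p ↦ coeff p n) (map_taylor g a M.subtype)).symm.trans (coeff_map _ _)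
  simp only [derivative_map, hev, hha] at h0 h1 hc ⊢
  obtain ⟨y, hy, hroot⟩ := (O.comap M.subtype).exists_isRoot_of_newton g a
    (fun h ↦ h0 (by simp [h])) (fun h ↦ h1 (by simp [h])) (fun i ↦ by
      have := hc i
      rw [mem_nonunits_iff_or] at this ⊢
      rw [mem_comap]
      refine this.imp (fun h ↦ Subtype.ext ?_) (fun h ↦ ?_)
      · simpa using h
      · simpa using h)
  obtain ⟨w, rfl⟩ := hy
  have hw : ((w⁻¹ : _ˣ) : ↥(O.comap M.subtype)) * (w : ↥(O.comap M.subtype)) = 1 := w.inv_mul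
  have hw' : (((w⁻¹ : _ˣ) : ↥(O.comap M.subtype)) : M) = ((w : ↥(O.comap M.subtype)) : M)⁻¹ :=
    eq_inv_of_mul_eq_one_left (congrArg Subtype.val hw)
  have hx : ((a + g.eval a / (g.derivative.eval a * (w : ↥(O.comap M.subtype))) : M) : K) =
      a + (g.eval a : M) / (g.derivative.eval a : M) *
        (((w⁻¹ : _ˣ) : ↥(O.comap M.subtype)) : M) := by
    rw [hw']
    push_cast
    rw [div_mul_eq_div_div, div_eq_mul_inv _ (((w : ↥(O.comap M.subtype)) : M) : K)]
  refine ⟨(((w⁻¹ : _ˣ) : ↥(O.comap M.subtype)) : M),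
    mem_comap.1 ((w⁻¹ : _ˣ) : ↥(O.comap M.subtype)).2, ?_, ?_⟩
  · rw [← hx, IsRoot, hev, hroot.eq_zero, M.coe_zero]
  · rw [← hx]
    exact Subtype.prop _

/-- A proper valuation subring is infinite. -/
theorem ValuationSubring.infinite_of_ne_top {K : Type*} [Field K] (O : ValuationSubring K)
    (hnt : O ≠ ⊤) : (O : Set K).Infinite := by
  intro hfin
  have : Finite O := hfin
  have hO : IsField O := Finite.isField_of_domain O
  refine hnt (_root_.eq_top_iff.2 fun x _ ↦ ?_)
  rcases O.mem_or_inv_mem x with hx | hx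
  · exact hx
  · by_cases hx0 : x = 0
    · exact hx0 ▸ O.zero_mem
    obtain ⟨y, hy⟩ := hO.mul_inv_cancel (a := ⟨x⁻¹, hx⟩)
      (fun h ↦ inv_ne_zero hx0 (congrArg Subtype.val h))
    have hy' : x⁻¹ * y = 1 := congrArg Subtype.val hy
    have : x = y := by field_simp at hy'; exact hy'.symm
    exact this ▸ y.2

/-- A nonzero element of the maximal ideal is transcendental over every finite subfield. -/
theorem ValuationSubring.transcendental_of_mem_nonunits {K : Type*} [Field K]
    (O : ValuationSubring K) (E : Subfield K) [Finite E] {t : K} (ht : t ∈ O.nonunits)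
    (ht0 : t ≠ 0) : Transcendental E t := by
  intro halg
  have := IntermediateField.adjoin.finiteDimensional halg.isIntegral
  have : Finite (IntermediateField.adjoin E {t}) := Module.finite_of_finite E
  let u : (IntermediateField.adjoin E {t})ˣ :=
    Units.mk0 ⟨t, IntermediateField.mem_adjoin_simple_self E t⟩ (fun h ↦ ht0
      (congrArg Subtype.val h))
  obtain ⟨n, hn, hun⟩ := (isOfFinOrder_of_finite u).exists_pow_eq_one
  have htn : t ^ n = 1 := congrArg (fun z : (IntermediateField.adjoin E {t})ˣ ↦ ((z : _) : K)) hun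
  have := congrArg O.valuation htn
  rw [map_pow, map_one] at this
  exact (pow_lt_one₀ zero_le ht hn.ne').ne this

open Polynomial in
/-- Evaluation of a polynomial over `F` is given by a term with parameters in `F`. -/
theorem exists_term_realize_eq_aeval {K : Type*} [Field K] (O : ValuationSubring K)
    (F : Subfield K) (p : F[X]) :
    letI := valStructure K O
    ∃ τ : (valLang[[(F : Set K)]]).Term (Fin 1),
      ∀ x : K, τ.realize (fun _ ↦ x) = aeval x p := by
  let := valStructure K O
  obtain ⟨plus, hplus⟩ : ∃ m : (valLang[[(F : Set K)]]).Functions 2,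
      ∀ x : Fin 2 → K, Structure.funMap m x = x 0 + x 1 :=
    ⟨Sum.inl (Sum.inl Ring.addFunc), fun _ ↦ rfl⟩
  obtain ⟨times, htimes⟩ : ∃ m : (valLang[[(F : Set K)]]).Functions 2,
      ∀ x : Fin 2 → K, Structure.funMap m x = x 0 * x 1 :=
    ⟨Sum.inl (Sum.inl Ring.mulFunc), fun _ ↦ rfl⟩
  induction p using Polynomial.induction_on' with
  | add p q hp hq =>
    obtain ⟨τ, hτ⟩ := hp
    obtain ⟨σ, hσ⟩ := hq
    refine ⟨plus.apply₂ τ σ, fun x ↦ ?_⟩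
    rw [Term.realize_functions_apply₂, hplus, map_add, ← hτ, ← hσ]
    rfl
  | monomial n a =>
    induction n with
    | zero =>
      refine ⟨(valLang.con (α := (F : Set K)) a).term, fun x ↦ ?_⟩
      rw [Term.realize_con, aeval_monomial, pow_zero, mul_one]
      rfl
    | succ n ih =>
      obtain ⟨τ, hτ⟩ := ih
      refine ⟨times.apply₂ τ (Term.var 0), fun x ↦ ?_⟩
      rw [Term.realize_functions_apply₂, htimes, ← monomial_mul_X, map_mul, ← hτ, aeval_X]
      rfl

open Polynomial in
/-- In a saturated valued field the valuation ring contains elements transcendental over any given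
small subfield. -/
theorem exists_mem_transcendental_of_isSaturatedIn {K : Type*} [Field K] (O : ValuationSubring K)
    (hnt : O ≠ ⊤) (F : Subfield K) (κ : Cardinal) (hF : Cardinal.mk F < κ)
    (hsat : letI := valStructure K O; IsSaturatedIn valLang K κ) :
    ∃ s ∈ O, Transcendental F s := by
  let := valStructure K O
  obtain ⟨s, hs⟩ := hsat (F : Set K) hF {φ | {x | x ∈ O ∧ ¬ φ.Realize (fun _ ↦ x)}.Finite} (by
    intro t ht
    have hfin : (⋃ φ ∈ t, {x | x ∈ O ∧ ¬ Formula.Realize φ (fun _ ↦ x)}).Finite :=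
      t.finite_toSet.biUnion fun φ hφ ↦ ht hφ
    obtain ⟨x, hxO, hx⟩ := ((O.infinite_of_ne_top hnt).sdiff hfin).nonempty
    refine ⟨x, fun φ hφ ↦ ?_⟩
    by_contra hcon
    exact hx (Set.mem_biUnion hφ ⟨hxO, hcon⟩))
  refine ⟨s, ?_, fun ⟨p, hp0, hps⟩ ↦ ?_⟩
  · let r : (valLang[[(F : Set K)]]).Relations 1 := Sum.inl (Sum.inr PUnit.unit)
    have hr : ∀ x : K, (r.formula₁ (Term.var (0 : Fin 1))).Realize (fun _ ↦ x) ↔ x ∈ O := by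
      intro x
      rw [Formula.realize_rel₁]
      rfl
    refine (hr s).1 (hs _ ?_)
    simp [hr]
  · obtain ⟨τ, hτ⟩ := exists_term_realize_eq_aeval O F p
    obtain ⟨σ, hσ⟩ := exists_term_realize_eq_aeval O F 0
    have hr : ∀ x : K, (Formula.not (τ.equal σ)).Realize (fun _ ↦ x) ↔ aeval x p ≠ 0 := by
      intro x
      rw [Formula.realize_not, Formula.realize_equal, hτ, hσ, map_zero]
    refine (hr s).1 (hs _ ?_) hps
    refine (p.rootSet_finite K).subset fun x hx ↦ ?_
    rw [Set.mem_ofPred_eq, hr, not_not] at hx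
    exact mem_rootSet.2 ⟨hp0, hx.2⟩

/-- In a saturated valued field, every disc around a point algebraic over a small subfield contains
elements transcendental over that subfield. -/
theorem exists_transcendental_add_mul {K : Type*} [Field K] (O : ValuationSubring K)
    (hnt : O ≠ ⊤) (E : Subfield K) (b d : K) (hb : IsAlgebraic E b) (hd : d ≠ 0)
    (hsat : letI := valStructure K O;
      IsSaturatedIn valLang K (Order.succ (Cardinal.mk ↥E))) :
    ∃ s ∈ O, Transcendental E (b + d * s) := by
  rcases finite_or_infinite E with hE | hE
  · by_cases hdE : IsAlgebraic E d
    · obtain ⟨t, ht⟩ : ∃ t, t ∉ O := by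
        by_contra! h
        exact hnt (_root_.eq_top_iff.2 fun x _ ↦ h x)
      have ht' : t⁻¹ ∈ O.nonunits := O.inv_mem_nonunits_iff.2 (Or.inr ht)
      have ht0 : t⁻¹ ≠ 0 := inv_ne_zero fun h ↦ ht (h ▸ O.zero_mem)
      refine ⟨t⁻¹, O.nonunits_le ht', fun halg ↦ ?_⟩
      refine O.transcendental_of_mem_nonunits E ht' ht0 ?_
      simpa [hd] using hdE.inv.mul (halg.sub hb)
    · refine ⟨1, O.one_mem, fun halg ↦ hdE ?_⟩
      simpa using halg.sub hb
  · set F : Subfield K := Subfield.closure ((E : Set K) ∪ {b, d}) with hFdef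
    have hEF : E ≤ F := fun x hx ↦ Subfield.subset_closure (Or.inl hx)
    have hbF : b ∈ F := Subfield.subset_closure (by simp)
    have hdF : d ∈ F := Subfield.subset_closure (by simp)
    have hcard : Cardinal.mk F ≤ Cardinal.mk E := by
      have hinf : Cardinal.aleph0 ≤ Cardinal.mk E := Cardinal.aleph0_le_mk E
      refine (Subfield.cardinalMk_closure_le_max _).trans (max_le ?_ hinf)
      refine (Cardinal.mk_union_le _ _).trans (Cardinal.add_le_of_le hinf le_rfl ?_)
      exact ((Set.toFinite {b, d}).lt_aleph0).le.trans hinf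
    obtain ⟨s, hsO, hs⟩ := exists_mem_transcendental_of_isSaturatedIn O hnt F _
      (Order.lt_succ_of_le hcard) hsat
    refine ⟨s, hsO, fun halg ↦ hs ?_⟩
    let : Algebra E F := (Subfield.inclusion hEF).toAlgebra
    have : IsScalarTower E F K := IsScalarTower.of_algebraMap_eq fun _ ↦ rfl
    have h1 : IsAlgebraic F (b + d * s) := halg.extendScalars (Subfield.inclusion hEF).injective
    have h2 : IsAlgebraic F b := isAlgebraic_algebraMap (⟨b, hbF⟩ : F)
    have h3 : IsAlgebraic F d⁻¹ := isAlgebraic_algebraMap (⟨d, hdF⟩⁻¹ : F)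
    have h4 := h3.mul (h1.sub h2)
    rwa [add_sub_cancel_left, inv_mul_cancel_left₀ hd] at h4

/-- In an `|E|⁺`-saturated henselian nontrivially valued field `(K,v)`, for `b ∈ K` separably
algebraic over a subfield `E` there is `b'` transcendental over `E` with `b` in the
henselization of `E(b')` inside `K` (the intersection of all subfields of `K` containing
`E(b')` on which the restricted valuation is henselian). -/
theorem stmt_6 (K : Type*) [Field K] (O : ValuationSubring K) (hnt : O ≠ ⊤)
    (hhens : HenselianLocalRing ↥O) (E : Subfield K) (b : K)
    (hb : IsSeparable ↥E b)
    (hsat : letI := valStructure K O;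
      IsSaturatedIn valLang K (Order.succ (Cardinal.mk ↥E))) :
    ∃ b' : K, Transcendental ↥E b' ∧
      ∀ M : Subfield K, E ≤ M → b' ∈ M →
        HenselianLocalRing ↥(O.comap M.subtype) → b ∈ M := by
  set f := (minpoly E b).map (algebraMap E K) with hf
  have hroot : f.IsRoot b := by
    rw [Polynomial.IsRoot, hf, Polynomial.eval_map_algebraMap, minpoly.aeval]
  have hder : f.derivative.eval b ≠ 0 := by
    rw [hf, Polynomial.derivative_map, Polynomial.eval_map_algebraMap]
    exact hb.aeval_derivative_ne_zero (minpoly.aeval E b)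
  obtain ⟨d, hd0, hd⟩ := O.exists_disc_newton hnt f b hroot hder
  obtain ⟨s, hsO, hs⟩ := exists_transcendental_add_mul O hnt E b d hb.isIntegral.isAlgebraic hd0 hsat
  refine ⟨b + d * s, hs, fun M hEM hM hens ↦ ?_⟩
  obtain ⟨h1, h2, h3⟩ := hd s hsO
  obtain ⟨u, huO, hu, huM⟩ := O.exists_isRoot_of_newton_subfield M hens
    ((minpoly E b).map (Subfield.inclusion hEM)) f (by rw [Polynomial.map_map]; rfl) _ hM
    (fun h ↦ hs ⟨minpoly E b, minpoly.ne_zero hb.isIntegral, by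
      rwa [hf, Polynomial.eval_map_algebraMap] at h⟩) h1 h2
  rwa [h3 u huO hu] at huM
end

section
/- Let $C' \subseteq F \subseteq K$ be a tower of fields of characteristic exponent $p$ and let $a \in K$. Suppose $C'$ is perfect and $F/C'$ is finitely generated. Then there exists $m \in \mathbb{N}$ such that $a^{p^{-m}} \in F(a)$ and $F(a)$ is a separable extension of $C'(a^{p^{-m}})$. -/
open IntermediateField

/-- A (possibly transcendental) field extension `L/E` is separable iff
`L ⊗_E Ē` is reduced (MacLane's criterion). -/
def IsSeparableFieldExt (E L : Type*) [Field E] [Field L] [Algebra E L] : Prop :=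
  IsReduced (TensorProduct E (AlgebraicClosure E) L)

/-- The subfield `F(a)` of `K` (as an intermediate field of `K/C'`). -/
def adjSelf (C' : Type*) (F : Type*) {K : Type*} [Field C'] [Field F] [Field K]
    [Algebra C' F] [Algebra F K] [Algebra C' K] (a : K) : IntermediateField C' K :=
  IntermediateField.adjoin C' (Set.range (algebraMap F K) ∪ {a})

open scoped TensorProduct in
lemma isReduced_tensorProduct_of_isSeparable (E M L : Type*) [Field E] [Field M] [Field L]
    [Algebra E M] [Algebra E L] [Algebra.IsSeparable E M] : IsReduced (M ⊗[E] L) := by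
  have : IsReduced (L ⊗[E] M) := by
    refine IsReduced.tensorProduct_of_flat_of_forall_fg fun B hB ↦ ?_
    let := (Subalgebra.isField_of_algebraic B).toField
    have : Algebra.FiniteType E B := B.fg_iff_finiteType.mp hB
    have : Algebra.IsSeparable E B := Algebra.IsSeparable.of_algHom E M B.val
    have : Algebra.FormallyUnramified E B := .of_isSeparable E B
    exact Algebra.FormallyUnramified.isReduced_of_field L (L ⊗[E] B)
  exact isReduced_of_injective _ (Algebra.TensorProduct.comm E M L).injective

open scoped TensorProduct in
lemma isReduced_tensorProduct_of_linearIndependent_pow {E L ι : Type*} (M : Type*) [Field E]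
    [Field M] [Field L] [Algebra E M] [Algebra E L] (p : ℕ) [Fact p.Prime] [CharP M p]
    (b : Module.Basis ι E L) (hb : LinearIndependent E fun i ↦ b i ^ p) :
    IsReduced (M ⊗[E] L) := by
  have : CharP (M ⊗[E] L) p :=
    charP_of_injective_algebraMap (algebraMap M (M ⊗[E] L)).injective p
  have hp : p.Prime := Fact.out
  rw [isReduced_iff_pow_one_lt p hp.one_lt]
  intro x hx
  let B := b.baseChange M
  have hli : LinearIndependent M fun i ↦ (1 : M) ⊗ₜ[E] (b i ^ p) :=
    Module.Flat.linearIndependent_one_tmul hb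
  rw [← B.linearCombination_repr x, Finsupp.linearCombination_apply, Finsupp.sum,
    sum_pow_char] at hx
  have hc := linearIndependent_iff'.mp hli (B.repr x).support (fun i ↦ B.repr x i ^ p) (by
    simpa [B, Algebra.smul_def, mul_pow, Module.Basis.baseChange_apply] using hx)
  rw [← B.repr.map_eq_zero_iff]
  ext i
  by_cases hi : i ∈ (B.repr x).support
  · simpa using (pow_eq_zero_iff hp.ne_zero).mp (hc i hi)
  · simpa using hi

/-- If `1, c, …, c ^ (p - 1)` span `E` over `E ^ p` and `c` has no `p`-th root in `L`, then taking
`p`-th powers preserves linear independence over `E`. -/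
lemma LinearIndependent.pow_char {E L ι : Type*} [Field E] [Field L] [Algebra E L] (p : ℕ)
    [Fact p.Prime] [CharP L p] {c : E} (hE : ∀ x : E, ∃ d : Fin p → E, x = ∑ j, d j ^ p * c ^ (j : ℕ))
    (hc : ∀ y : L, y ^ p ≠ algebraMap E L c) {v : ι → L} (hv : LinearIndependent E v) :
    LinearIndependent E fun i ↦ v i ^ p := by
  have hp : p.Prime := Fact.out
  have key (y : Fin p → L) (hy : ∑ j, y j ^ p * algebraMap E L c ^ (j : ℕ) = 0) (j) : y j = 0 := by
    obtain ⟨β, hβ⟩ :=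
      IsAlgClosed.exists_pow_nat_eq (algebraMap L (AlgebraicClosure L) (algebraMap E L c)) hp.pos
    have hmin : minpoly L β = Polynomial.X ^ p - Polynomial.C (algebraMap E L c) :=
      (minpoly.eq_of_irreducible_of_monic (X_pow_sub_C_irreducible_of_prime hp hc) (by simp [hβ])
        (Polynomial.monic_X_pow_sub_C _ hp.ne_zero)).symm
    have hdeg : (minpoly L β).natDegree = p := by rw [hmin, Polynomial.natDegree_X_pow_sub_C]
    have hli := linearIndependent_pow (K := L) β
    rw [hdeg] at hli
    refine Fintype.linearIndependent_iff.mp hli y ((pow_eq_zero_iff hp.ne_zero).mp ?_) j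
    have : CharP (AlgebraicClosure L) p :=
      charP_of_injective_algebraMap (algebraMap L (AlgebraicClosure L)).injective p
    rw [sum_pow_char, ← map_zero (algebraMap L (AlgebraicClosure L)), ← hy, map_sum]
    refine Finset.sum_congr rfl fun i _ ↦ ?_
    rw [Algebra.smul_def, mul_pow, map_mul, map_pow, map_pow, ← hβ, ← pow_mul, ← pow_mul,
      mul_comm p]
  rw [linearIndependent_iff'] at hv ⊢
  intro s g hg i hi
  choose d hd using hE
  have h0 : ∑ j : Fin p, (∑ i ∈ s, d (g i) j • v i) ^ p * algebraMap E L c ^ (j : ℕ) = 0 := by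
    simp_rw [sum_pow_char, Finset.sum_mul]
    rw [Finset.sum_comm, ← hg]
    refine Finset.sum_congr rfl fun i _ ↦ ?_
    conv_rhs => rw [hd (g i)]
    simp only [Algebra.smul_def, map_sum, map_mul, map_pow, Finset.sum_mul, mul_pow]
    exact Finset.sum_congr rfl fun j _ ↦ by ring
  rw [hd (g i)]
  refine Finset.sum_eq_zero fun j _ ↦ ?_
  rw [hv s _ (key _ h0 j) i hi, zero_pow hp.ne_zero, zero_mul]

lemma exists_eq_sum_pow_mul_pow_of_adjoin_simple {k L : Type*} [Field k] [Field L] [Algebra k L]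
    [PerfectField k] (p : ℕ) [Fact p.Prime] [CharP k p] (b : L) (x : k⟮b⟯) :
    ∃ d : Fin p → k⟮b⟯, x = ∑ j, d j ^ p * AdjoinSimple.gen k b ^ (j : ℕ) := by
  have hp : p.Prime := Fact.out
  have : CharP k⟮b⟯ p := charP_of_injective_algebraMap (algebraMap k k⟮b⟯).injective p
  have hpoly (q : Polynomial k) : ∃ d : Fin p → k⟮b⟯,
      Polynomial.aeval (AdjoinSimple.gen k b) q = ∑ j, d j ^ p * AdjoinSimple.gen k b ^ (j : ℕ) := by
    induction q using Polynomial.induction_on' with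
    | add f g hf hg =>
      obtain ⟨d, hd⟩ := hf
      obtain ⟨e, he⟩ := hg
      exact ⟨d + e, by simp [hd, he, add_pow_char, add_mul, Finset.sum_add_distrib]⟩
    | monomial n r =>
      obtain ⟨s, rfl⟩ := surjective_frobenius k p r
      refine ⟨Pi.single ⟨n % p, n.mod_lt hp.pos⟩
        (algebraMap k _ s * AdjoinSimple.gen k b ^ (n / p)), ?_⟩
      rw [Finset.sum_eq_single ⟨n % p, n.mod_lt hp.pos⟩]
      · simp only [Polynomial.aeval_monomial, frobenius_def, Pi.single_eq_same, map_pow]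
        rw [mul_pow, mul_assoc, ← pow_mul, ← pow_add, Nat.div_add_mod']
      · intro j _ hj
        simp [Pi.single_eq_of_ne hj, hp.ne_zero]
      · simp
  obtain ⟨r, s, hx⟩ := (mem_adjoin_simple_iff k (x : L)).mp x.2
  obtain ⟨d, hd⟩ := hpoly (r * s ^ (p - 1))
  set t := Polynomial.aeval (AdjoinSimple.gen k b) s with ht
  have hx' : x = Polynomial.aeval (AdjoinSimple.gen k b) r / t := by
    apply Subtype.ext
    have (q : Polynomial k) : ((Polynomial.aeval (AdjoinSimple.gen k b) q : k⟮b⟯) : L) =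
        Polynomial.aeval b q := by
      rw [← IntermediateField.aeval_coe, AdjoinSimple.coe_gen]
    rw [hx, IntermediateField.coe_div, this, this]
  by_cases h0 : t = 0
  · exact ⟨0, by simp [hx', h0, hp.ne_zero]⟩
  refine ⟨fun j ↦ d j / t, ?_⟩
  have : x = Polynomial.aeval (AdjoinSimple.gen k b) (r * s ^ (p - 1)) / t ^ p := by
    rw [hx', map_mul, map_pow, ← ht, div_eq_div_iff h0 (pow_ne_zero _ h0), mul_assoc, ← pow_succ,
      Nat.sub_add_cancel hp.one_le]
  rw [this, hd, Finset.sum_div]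
  exact Finset.sum_congr rfl fun j _ ↦ by rw [div_pow]; ring

lemma notMem_adjoin_simple_pow_of_transcendental {k L : Type*} [Field k] [Field L] [Algebra k L]
    {c : L} (hc : Transcendental k c) {n : ℕ} (hn : 1 < n) : c ∉ k⟮c ^ n⟯ := by
  intro h
  obtain ⟨r, s, h⟩ := (mem_adjoin_simple_iff k c).mp h
  have hc0 : c ≠ 0 := by
    rintro rfl
    exact hc isAlgebraic_zero
  have hs : Polynomial.aeval (c ^ n) s ≠ 0 := by
    intro h0
    rw [h0, div_zero] at h
    exact hc0 h
  rw [eq_div_iff hs] at h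
  have heq : Polynomial.X * Polynomial.expand k n s = Polynomial.expand k n r :=
    transcendental_iff_injective.mp hc (by simpa [Polynomial.expand_aeval] using h)
  have hs0 : s ≠ 0 := by
    rintro rfl
    simp at hs
  have := congrArg Polynomial.natDegree heq
  rw [Polynomial.natDegree_X_mul (by rwa [Ne, Polynomial.expand_eq_zero (by lia)]),
    Polynomial.natDegree_expand, Polynomial.natDegree_expand] at this
  have := congrArg (· % n) this
  simp [Nat.add_mod, Nat.mod_eq_of_lt hn] at this

lemma exists_pow_eq_of_finiteDimensional_adjoin_simple {k L : Type*} [Field k] [Field L]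
    [Algebra k L] {p : ℕ} (hp : p.Prime) (a : L) (ha : Transcendental k a)
    [FiniteDimensional k⟮a⟯ L] :
    ∃ (m : ℕ) (b : L), b ^ p ^ m = a ∧ ∀ y : L, y ^ p ≠ b := by
  induction hn : Module.finrank k⟮a⟯ L using Nat.strong_induction_on generalizing a with
  | _ n ih =>
    by_cases hroot : ∃ c : L, c ^ p = a
    · obtain ⟨c, rfl⟩ := hroot
      have hc : Transcendental k c := fun h ↦ ha (h.pow p)
      have hle : k⟮c ^ p⟯ ≤ k⟮c⟯ :=
        adjoin_simple_le_iff.mpr (pow_mem (mem_adjoin_simple_self k c) p)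
      have hfin : FiniteDimensional k⟮c⟯ L := by
        let := (IntermediateField.inclusion hle).toRingHom.toAlgebra
        have : IsScalarTower k⟮c ^ p⟯ k⟮c⟯ L := .of_algebraMap_eq fun _ ↦ rfl
        exact .right k⟮c ^ p⟯ k⟮c⟯ L
      have hlt : Module.finrank k⟮c⟯ L < n := by
        by_contra! h
        have := eq_of_le_of_finrank_le' hle (hn.trans_le h)
        exact notMem_adjoin_simple_pow_of_transcendental hc hp.one_lt
          (this ▸ mem_adjoin_simple_self k c)
      obtain ⟨m, b, hb, hb'⟩ := ih _ hlt c hc rfl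
      exact ⟨m + 1, b, by rw [pow_succ, pow_mul, hb], hb'⟩
    · exact ⟨0, a, by simp, by simpa using hroot⟩

/-- In a finitely generated field extension, a transcendental element has only finitely many
iterated `p`-th roots. -/
lemma Transcendental.exists_pow_eq {k L : Type*} [Field k] [Field L]
    [Algebra k L] [Algebra.EssFiniteType k L] {p : ℕ} (hp : p.Prime) {a : L}
    (ha : Transcendental k a) :
    ∃ (m : ℕ) (b : L), b ^ p ^ m = a ∧ ∀ y : L, y ^ p ≠ b := by
  obtain ⟨t, hat, ht⟩ := exists_isTranscendenceBasis_superset (R := k) (s := {a})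
    ((algebraicIndependent_singleton_iff (⟨a, rfl⟩ : ({a} : Set L))).mpr ha)
  have hat : a ∈ t := hat rfl
  let k' := adjoin k (t \ {a})
  have ha' : Transcendental k' a := by
    have := ht.1.transcendental_adjoin (s := {x | x.1 ≠ a}) (i := ⟨a, hat⟩) (by simp)
    rw [show ((↑) : t → L) '' {x | x.1 ≠ a} = t \ {a} by ext; aesop] at this
    exact fun h ↦ this (isAlgebraic_adjoin_iff.mp h)
  have hadj : k'⟮a⟯.restrictScalars k = adjoin k t := by
    rw [adjoin_adjoin_left, Set.sdiff_union_of_subset (by simpa)]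
  have : Algebra.IsAlgebraic k'⟮a⟯ L := by
    have := ht.isAlgebraic_field
    rw [Subtype.range_coe, ← hadj] at this
    exact this
  have : Algebra.EssFiniteType k' L := .of_comp k _ _
  have : Algebra.EssFiniteType k'⟮a⟯ L := .of_comp k' _ _
  have : FiniteDimensional k'⟮a⟯ L := Algebra.finite_of_essFiniteType_of_isAlgebraic
  exact exists_pow_eq_of_finiteDimensional_adjoin_simple hp a ha'

lemma essFiniteType_adjSelf {C' F K : Type*} [Field C'] [Field F] [Field K]
    [Algebra C' F] [Algebra F K] [Algebra C' K] [IsScalarTower C' F K]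
    (hFG : ∃ s : Finset F, IntermediateField.adjoin C' (↑s : Set F) = ⊤) (a : K) :
    Algebra.EssFiniteType C' (adjSelf C' F a) := by
  classical
  obtain ⟨s, hs⟩ := hFG
  refine essFiniteType_iff.mpr ⟨s.image (algebraMap F K) ∪ {a}, ?_⟩
  have := adjoin_map C' (s : Set F) (IsScalarTower.toAlgHom C' F K)
  rw [hs, ← AlgHom.fieldRange_eq_map] at this
  have hrange : Set.range (algebraMap F K) =
      (IntermediateField.adjoin C' (algebraMap F K '' (s : Set F)) : Set K) :=
    congrArg SetLike.coe this
  rw [adjSelf, hrange, Finset.coe_union, Finset.coe_image, Finset.coe_singleton, adjoin_union,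
    adjoin_union, adjoin_self]

/-- Over a perfect field `k`, an extension of `k(b)` containing no `p`-th root of `b` is
separable. -/
lemma isSeparableFieldExt_of_forall_pow_ne {k K : Type*} [Field k] [Field K] [Algebra k K]
    [PerfectField k] (p : ℕ) [Fact p.Prime] [CharP k p] {b : K} {L : Type*} [Field L]
    [Algebra k⟮b⟯ L] (hb : ∀ y : L, y ^ p ≠ algebraMap k⟮b⟯ L (AdjoinSimple.gen k b)) :
    IsSeparableFieldExt k⟮b⟯ L := by
  have : CharP k⟮b⟯ p := charP_of_injective_algebraMap (algebraMap k k⟮b⟯).injective p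
  have : CharP L p := charP_of_injective_algebraMap (algebraMap k⟮b⟯ L).injective p
  have : CharP (AlgebraicClosure k⟮b⟯) p :=
    charP_of_injective_algebraMap (algebraMap k⟮b⟯ (AlgebraicClosure k⟮b⟯)).injective p
  let B := Module.Basis.ofVectorSpace k⟮b⟯ L
  exact isReduced_tensorProduct_of_linearIndependent_pow _ p B
    (B.linearIndependent.pow_char p (exists_eq_sum_pow_mul_pow_of_adjoin_simple p b) hb)

lemma isSeparableFieldExt_of_perfectField (E L : Type*) [Field E] [Field L] [Algebra E L]
    [PerfectField E] : IsSeparableFieldExt E L :=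
  isReduced_tensorProduct_of_isSeparable E (AlgebraicClosure E) L

/-- For a tower `C' ⊆ F ⊆ K` of fields of characteristic exponent `p` with `C'` perfect and
`F/C'` finitely generated, and `a ∈ K`, there is `m` with `a^{p^{-m}} ∈ F(a)` and
`F(a)/C'(a^{p^{-m}})` separable. -/
theorem stmt_7 (p : ℕ) (C' F K : Type*) [Field C'] [Field F] [Field K]
    [Algebra C' F] [Algebra F K] [Algebra C' K] [IsScalarTower C' F K]
    [ExpChar K p] [PerfectField C']
    (hFG : ∃ s : Finset F, IntermediateField.adjoin C' (↑s : Set F) = ⊤) (a : K) :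
    ∃ (m : ℕ) (b : K) (_ : b ∈ adjSelf C' F a),
      b ^ p ^ m = a ∧
      ∃ h : IntermediateField.adjoin C' ({b} : Set K) ≤ adjSelf C' F a,
        letI := (IntermediateField.inclusion h).toRingHom.toAlgebra
        IsSeparableFieldExt ↥(IntermediateField.adjoin C' ({b} : Set K))
          ↥(adjSelf C' F a) := by
  have hC : ExpChar C' p := by
    obtain ⟨q, hq⟩ := ExpChar.exists C'
    exact (expChar_of_injective_algebraMap (algebraMap C' K).injective q).eq ‹ExpChar K p› ▸ hq
  have hle {b : K} (hb : b ∈ adjSelf C' F a) : C'⟮b⟯ ≤ adjSelf C' F a :=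
    adjoin_simple_le_iff.mpr hb
  have ha : a ∈ adjSelf C' F a := subset_adjoin _ _ (.inr rfl)
  by_cases hperf : PerfectField C'⟮a⟯
  · exact ⟨0, a, ha, by simp, hle ha, @isSeparableFieldExt_of_perfectField _ _ _ _ (_) _⟩
  have htr : Transcendental C' (⟨a, ha⟩ : adjSelf C' F a) := by
    intro h
    have : FiniteDimensional C' C'⟮a⟯ :=
      adjoin.finiteDimensional (h.algebraMap (A := K)).isIntegral
    exact hperf (Algebra.IsAlgebraic.perfectField C')
  cases hC with
  | zero =>
    have : CharZero C'⟮a⟯ := charZero_of_injective_algebraMap (algebraMap C' C'⟮a⟯).injective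
    exact (hperf inferInstance).elim
  | prime hp =>
    have : Fact p.Prime := ⟨hp⟩
    have := essFiniteType_adjSelf hFG a
    obtain ⟨m, b, hb, hroot⟩ := htr.exists_pow_eq hp
    refine ⟨m, b, b.2, congrArg Subtype.val hb, hle b.2, ?_⟩
    let := (IntermediateField.inclusion (hle b.2)).toRingHom.toAlgebra
    exact isSeparableFieldExt_of_forall_pow_ne p hroot
end

section
/- The field $\mathbb{Q}$ does not have embedded residue: if $F_1$ is a field elementarily equivalent to $\mathbb{Q}$ and $v$ is a nontrivial valuation on $F_1$, then the residue field $F_1 v$ does not embed into any field $F_2$ elementarily equivalent to $\mathbb{Q}$. -/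
open FirstOrder

/-- Two rings are elementarily equivalent in the language of rings. -/
def RingElemEquiv (F₁ : Type*) (F₂ : Type*) [Ring F₁] [Ring F₂] : Prop :=
  letI := Ring.compatibleRingOfRing F₁
  letI := Ring.compatibleRingOfRing F₂
  F₁ ≅[Language.ring] F₂

namespace RingElemEquiv

open Language Ring

/-- The sentence saying that `2` is not a square. -/
def twoNotSquare : Language.ring.Sentence :=
  ∀' ∼((&0 * &0 : Language.ring.Term (Empty ⊕ Fin 1)) =' (1 + 1))

/-- The sentence saying that `-1` is not a sum of seven squares. -/
def negOneNotSumSq : Language.ring.Sentence :=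
  ∀' ∀' ∀' ∀' ∀' ∀' ∀' ∼((1 + &0 * &0 + &1 * &1 + &2 * &2 + &3 * &3 + &4 * &4 + &5 * &5 + &6 * &6 :
    Language.ring.Term (Empty ⊕ Fin 7)) =' 0)

/-- The sentence saying that, for every nonzero `e`, there is an `a` such that `2 - a ^ 2` is a sum
of four squares which, together with four more squares, sum to `e ^ 2`. -/
def approxSqrtTwo : Language.ring.Sentence :=
  ∀' (∼((&0 : Language.ring.Term (Empty ⊕ Fin 1)) =' 0) ⟹
    ∃' ∃' ∃' ∃' ∃' ∃' ∃' ∃' ∃'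
      (((&1 * &1 + (&2 * &2 + &3 * &3 + &4 * &4 + &5 * &5) :
          Language.ring.Term (Empty ⊕ Fin 10)) =' (1 + 1)) ⊓
        ((&2 * &2 + &3 * &3 + &4 * &4 + &5 * &5 + &6 * &6 + &7 * &7 + &8 * &8 + &9 * &9 :
          Language.ring.Term (Empty ⊕ Fin 10)) =' (&0 * &0))))

section Realize

variable {K : Type*} [Field K] [CompatibleRing K]

theorem realize_twoNotSquare : K ⊨ twoNotSquare ↔ ∀ x : K, x * x ≠ 1 + 1 := by
  simp [twoNotSquare, Sentence.Realize, Formula.Realize, Fin.snoc]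

theorem realize_negOneNotSumSq : K ⊨ negOneNotSumSq ↔ ∀ a b c d e f g : K,
    1 + a * a + b * b + c * c + d * d + e * e + f * f + g * g ≠ 0 := by
  simp [negOneNotSumSq, Sentence.Realize, Formula.Realize, Fin.snoc]

theorem realize_approxSqrtTwo : K ⊨ approxSqrtTwo ↔ ∀ e : K, e ≠ 0 → ∃ a b c d f g h i j : K,
    a * a + (b * b + c * c + d * d + f * f) = 1 + 1 ∧
      b * b + c * c + d * d + f * f + g * g + h * h + i * i + j * j = e * e := by
  simp [approxSqrtTwo, Sentence.Realize, Formula.Realize, Fin.snoc]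

end Realize

variable {F : Type*} [Field F]

theorem realize_iff (h : RingElemEquiv F ℚ) (φ : Language.ring.Sentence) :
    letI := compatibleRingOfRing F
    letI := compatibleRingOfRing ℚ
    F ⊨ φ ↔ ℚ ⊨ φ :=
  letI := compatibleRingOfRing F
  letI := compatibleRingOfRing ℚ
  ElementarilyEquivalent.realize_sentence h φ

theorem mul_self_ne_two (h : RingElemEquiv F ℚ) (x : F) : x * x ≠ 1 + 1 := by
  let := compatibleRingOfRing F
  let := compatibleRingOfRing ℚ
  refine realize_twoNotSquare.1 ((h.realize_iff twoNotSquare).2 (realize_twoNotSquare.2 ?_)) x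
  intro x hx
  have : IsSquare (2 : ℚ) := ⟨x, by rw [hx]; norm_num⟩
  rw [Rat.isSquare_iff] at this
  exact Nat.prime_two.not_isSquare (by simpa using this)

theorem one_add_sum_sq_ne_zero (h : RingElemEquiv F ℚ) (a b c d e f g : F) :
    1 + a * a + b * b + c * c + d * d + e * e + f * f + g * g ≠ 0 := by
  let := compatibleRingOfRing F
  let := compatibleRingOfRing ℚ
  refine realize_negOneNotSumSq.1
    ((h.realize_iff negOneNotSumSq).2 (realize_negOneNotSumSq.2 ?_)) a b c d e f g
  intro a b c d e f g
  nlinarith [mul_self_nonneg a, mul_self_nonneg b, mul_self_nonneg c, mul_self_nonneg d,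
    mul_self_nonneg e, mul_self_nonneg f, mul_self_nonneg g]

end RingElemEquiv

theorem Rat.exists_sum_four_squares {q : ℚ} (hq : 0 ≤ q) :
    ∃ a b c d : ℚ, a * a + b * b + c * c + d * d = q := by
  obtain ⟨a, b, c, d, h⟩ := Nat.sum_four_squares (q.num.toNat * q.den)
  have hnum : ((q.num.toNat : ℕ) : ℚ) = q.num := by
    exact_mod_cast Int.toNat_of_nonneg (Rat.num_nonneg.2 hq)
  have hden : (q.den : ℚ) ≠ 0 := by exact_mod_cast q.den_ne_zero
  have h' : (a : ℚ) ^ 2 + b ^ 2 + c ^ 2 + d ^ 2 = q.num * q.den := by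
    rw [← hnum]; exact_mod_cast h
  refine ⟨a / q.den, b / q.den, c / q.den, d / q.den, ?_⟩
  have hq' : (q.num : ℚ) = q * q.den := (Rat.mul_den_eq_num q).symm
  rw [hq'] at h'
  field_simp
  linear_combination h'

theorem Rat.exists_mul_self_le_two {ε : ℚ} (hε : 0 < ε) :
    ∃ a : ℚ, a * a ≤ 2 ∧ 2 - a * a ≤ ε := by
  obtain ⟨a, ha, ha'⟩ := exists_rat_btwn
    (show max 0 (√2 - ε / 4) < √2 from max_lt (by positivity) (by
      have : (0 : ℝ) < ε := by exact_mod_cast hε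
      linarith))
  have h0 : (0 : ℝ) < a := (le_max_left _ _).trans_lt ha
  have h1 : √2 - ε / 4 < (a : ℝ) := (le_max_right _ _).trans_lt ha
  have h2 : √2 * √2 = 2 := Real.mul_self_sqrt (by norm_num)
  have h3 : √2 < 2 := by nlinarith [Real.sqrt_nonneg 2]
  have h4 : (0 : ℝ) < ε := by exact_mod_cast hε
  refine ⟨a, ?_, ?_⟩
  · have : (a : ℝ) * a ≤ 2 := by nlinarith
    exact_mod_cast this
  · have : (2 : ℝ) - a * a ≤ ε := by nlinarith
    exact_mod_cast this

namespace RingElemEquiv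

open Language Ring

theorem exists_approx_sqrt_two {F : Type*} [Field F] (h : RingElemEquiv F ℚ) {e : F} (he : e ≠ 0) :
    ∃ a b c d f g h i j : F, a * a + (b * b + c * c + d * d + f * f) = 1 + 1 ∧
      b * b + c * c + d * d + f * f + g * g + h * h + i * i + j * j = e * e := by
  let := compatibleRingOfRing F
  let := compatibleRingOfRing ℚ
  refine realize_approxSqrtTwo.1
    ((h.realize_iff approxSqrtTwo).2 (realize_approxSqrtTwo.2 ?_)) e he
  intro e he
  obtain ⟨a, ha, ha'⟩ := Rat.exists_mul_self_le_two (mul_self_pos.2 he)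
  obtain ⟨b, c, d, f, h₁⟩ := Rat.exists_sum_four_squares (sub_nonneg.2 ha)
  obtain ⟨g, h, i, j, h₂⟩ := Rat.exists_sum_four_squares (sub_nonneg.2 ha')
  exact ⟨a, b, c, d, f, g, h, i, j, by linarith, by linarith⟩

end RingElemEquiv

/-- If the residue field of `O` maps to a ring in which a sum of squares indexed by `ι` including
a `1` is never zero, then the square of an element of the maximal ideal of `O` can only be a sum of
squares of elements of the maximal ideal. -/
theorem ValuationSubring.valuation_lt_one_of_sum_sq_eq {K R ι : Type*} [Field K] [CommRing R]
    [Fintype ι] {O : ValuationSubring K} (φ : IsLocalRing.ResidueField O →+* R)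
    (hR : ∀ (y : ι → R) (i : ι), y i = 1 → ∑ j, y j ^ 2 ≠ 0)
    {t : K} (ht : O.valuation t < 1) {x : ι → K} (hx : ∑ j, x j ^ 2 = t ^ 2) (j : ι) :
    O.valuation (x j) < 1 := by
  have : Nonempty ι := ⟨j⟩
  obtain ⟨i, hi⟩ := Finite.exists_max fun j => O.valuation (x j)
  refine (hi j).trans_lt (lt_of_not_ge fun h1 => ?_)
  have hpos : 0 < O.valuation (x i) := zero_lt_one.trans_le h1
  have hne : x i ≠ 0 := (O.valuation.pos_iff).1 hpos
  have hy (j : ι) : x j / x i ∈ O := by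
    rw [← O.valuation_le_one_iff, map_div₀]
    exact div_le_one_of_le₀ (hi j) zero_le
  have hs : O.valuation (t / x i) < 1 := by
    rw [map_div₀]
    exact (div_lt_one₀ hpos).2 (ht.trans_le h1)
  let s : O := ⟨t / x i, O.valuation_le_one_iff _ |>.1 hs.le⟩
  let y (j : ι) : O := ⟨x j / x i, hy j⟩
  have hsum : ∑ j, y j ^ 2 = s ^ 2 := by
    apply Subtype.ext
    simp only [AddSubmonoidClass.coe_finsetSum, SubmonoidClass.coe_pow, y, s, div_pow]
    rw [← Finset.sum_div, hx]
  have hs0 : IsLocalRing.residue O s = 0 :=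
    (IsLocalRing.residue_eq_zero_iff s).2 ((O.valuation_lt_one_iff s).2 hs)
  refine hR (fun j => φ (IsLocalRing.residue O (y j))) i ?_ ?_
  · have : y i = 1 := Subtype.ext (div_self hne)
    simp [this]
  · simp only [← map_pow, ← map_sum, hsum]
    simp [hs0]

/-- `ℚ` does not have embedded residue: if `F₁ ≡ ℚ` carries a nontrivial valuation, then its
residue field does not embed into any field `F₂ ≡ ℚ`. -/
theorem stmt_9 {F₁ F₂ : Type*} [Field F₁] [Field F₂]
    (h₁ : RingElemEquiv F₁ ℚ) (h₂ : RingElemEquiv F₂ ℚ)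
    (O : ValuationSubring F₁) (hO : O ≠ ⊤) :
    IsEmpty (IsLocalRing.ResidueField ↥O →+* F₂) := by
  refine ⟨fun φ => ?_⟩
  obtain ⟨u, hu⟩ : ∃ u, u ∉ O := by
    by_contra! h
    exact hO (eq_top_iff.2 fun u _ => h u)
  have hu0 : u ≠ 0 := fun h => hu (h ▸ O.zero_mem)
  have ht : O.valuation u⁻¹ < 1 := by
    rw [← O.valuation_le_one_iff, not_le] at hu
    rw [map_inv₀]
    exact inv_lt_one_of_one_lt₀ hu
  obtain ⟨a, b, c, d, f, g, h, i, j, ha, hsum⟩ := h₁.exists_approx_sqrt_two (inv_ne_zero hu0)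
  have hR (y : Fin 8 → F₂) (k : Fin 8) (hk : y k = 1) : ∑ l, y l ^ 2 ≠ 0 := by
    rw [Fin.sum_univ_succAbove _ k, hk]
    intro h0
    refine h₂.one_add_sum_sq_ne_zero (y (k.succAbove 0)) (y (k.succAbove 1)) (y (k.succAbove 2))
      (y (k.succAbove 3)) (y (k.succAbove 4)) (y (k.succAbove 5)) (y (k.succAbove 6)) ?_
    rw [Fin.sum_univ_seven] at h0
    linear_combination h0
  have hlt := ValuationSubring.valuation_lt_one_of_sum_sq_eq φ hR ht
    (x := ![b, c, d, f, g, h, i, j]) (by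
      simp only [Fin.sum_univ_eight, Matrix.cons_val]
      linear_combination hsum)
  have hsq {z : F₁} (hz : O.valuation z < 1) : O.valuation (z * z) < 1 := by
    rw [map_mul]
    exact mul_lt_one' hz hz
  have hr : O.valuation (b * b + c * c + d * d + f * f) < 1 :=
    O.valuation.map_add_lt (O.valuation.map_add_lt (O.valuation.map_add_lt
      (hsq (hlt 0)) (hsq (hlt 1))) (hsq (hlt 2))) (hsq (hlt 3))
  let r : O := ⟨_, (O.valuation_le_one_iff _).1 hr.le⟩
  have haO : a ∈ O := by
    have haa : a * a ∈ O := by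
      rw [eq_sub_of_add_eq ha]
      exact sub_mem (add_mem O.one_mem O.one_mem) r.2
    rw [← O.valuation_le_one_iff] at haa ⊢
    rw [map_mul] at haa
    by_contra! hlt'
    exact haa.not_gt (one_lt_mul'' hlt' hlt')
  have hr0 : IsLocalRing.residue O r = 0 :=
    (IsLocalRing.residue_eq_zero_iff r).2 ((O.valuation_lt_one_iff r).2 hr)
  have hres : (⟨a, haO⟩ : O) * ⟨a, haO⟩ + r = 1 + 1 := Subtype.ext ha
  apply_fun fun z => φ (IsLocalRing.residue O z) at hres
  simp only [map_add, map_mul, map_one, hr0, add_zero] at hres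
  exact h₂.mul_self_ne_two _ hres
end

section
/- A field $F$ has embedded residue if and only if there is an elementary extension $F \preceq F^*$ and a nontrivial valuation $v$ on $F^*$ with an embedding of $F^* v$ into $F^*$. -/
open FirstOrder

universe u

/-- A ring homomorphism is an elementary embedding for the language of rings. -/
def IsElementaryRingHom {F F' : Type*} [Ring F] [Ring F'] (f : F →+* F') : Prop :=
  letI := Ring.compatibleRingOfRing F
  letI := Ring.compatibleRingOfRing F'
  ∀ (n : ℕ) (φ : Language.ring.Formula (Fin n)) (v : Fin n → F),
    φ.Realize (f ∘ v) ↔ φ.Realize v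

/-- A field `F` has embedded residue if there are fields `F₁ ≡ F` and `F₂ ≡ F` and a nontrivial
valuation on `F₁` whose residue field embeds into `F₂`. -/
def HasEmbeddedResidue (F : Type u) [Field F] : Prop :=
  ∃ (F₁ : Type u) (i₁ : Field F₁) (F₂ : Type u) (i₂ : Field F₂),
    letI := i₁
    letI := i₂
    RingElemEquiv F F₁ ∧ RingElemEquiv F F₂ ∧
      ∃ O : ValuationSubring F₁, O ≠ ⊤ ∧
        Nonempty (IsLocalRing.ResidueField ↥O →+* F₂)

open FirstOrder.Language FirstOrder.Ring Filter

section ElementaryRingHom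

attribute [local instance] compatibleRingOfRing

namespace IsElementaryRingHom

variable {K L M : Type*} [Ring K] [Ring L] [Ring M]

/-- The elementary embedding underlying an elementary ring homomorphism. -/
def toElementaryEmbedding {f : K →+* L} (hf : IsElementaryRingHom f) : K ↪ₑ[Language.ring] L :=
  ⟨f, hf⟩

theorem ringElemEquiv {f : K →+* L} (hf : IsElementaryRingHom f) : RingElemEquiv K L :=
  hf.toElementaryEmbedding.elementarilyEquivalent

theorem realize_boundedFormula {f : K →+* L} (hf : IsElementaryRingHom f) {α : Type*} {n : ℕ}
    (φ : Language.ring.BoundedFormula α n) (v : α → K) (xs : Fin n → K) :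
    φ.Realize (f ∘ v) (f ∘ xs) ↔ φ.Realize v xs :=
  hf.toElementaryEmbedding.map_boundedFormula φ v xs

theorem id : IsElementaryRingHom (RingHom.id K) := fun _ _ _ => Iff.rfl

theorem comp {g : L →+* M} {f : K →+* L} (hg : IsElementaryRingHom g)
    (hf : IsElementaryRingHom f) : IsElementaryRingHom (g.comp f) :=
  fun n φ v => (hg n φ (f ∘ v)).trans (hf n φ v)

end IsElementaryRingHom

theorem RingElemEquiv.symm {K L : Type*} [Ring K] [Ring L] (h : RingElemEquiv K L) :
    RingElemEquiv L K :=
  ElementarilyEquivalent.symm h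

theorem RingElemEquiv.trans {K L M : Type*} [Ring K] [Ring L] [Ring M] (h : RingElemEquiv K L)
    (h' : RingElemEquiv L M) : RingElemEquiv K M :=
  ElementarilyEquivalent.trans h h'

theorem RingHom.realize_term {K L : Type*} [Ring K] [Ring L] (f : K →+* L) {α : Type*}
    (t : Language.ring.Term α) (v : α → K) : t.realize (f ∘ v) = f (t.realize v) := by
  induction t with
  | var => rfl
  | func c ts ih =>
    simp only [Term.realize, ih]
    cases c <;> simp [Structure.funMap]

/-- Łoś's theorem for the ring of germs along an ultrafilter. -/
theorem Filter.Germ.realize_formula {ι K β : Type*} [Field K] (U : Ultrafilter ι)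
    (φ : Language.ring.Formula β) (x : β → ι → K) :
    φ.Realize (fun b => ((x b : ι → K) : Germ (U : Filter ι) K)) ↔
      ∀ᶠ i in (U : Filter ι), φ.Realize fun b => x b i := by
  rw [← Ultraproduct.realize_formula_cast]
  let e : (U : Filter ι).Product (fun _ => K) ≃[Language.ring] Germ (U : Filter ι) K :=
    { toFun := fun x => x
      invFun := fun x => x
      left_inv := fun _ => rfl
      right_inv := fun _ => rfl
      map_fun' := fun {n} f x => by
        obtain ⟨y, rfl⟩ : ∃ y : Fin n → ι → K,
            x = fun i => ((y i : ι → K) : (U : Filter ι).Product (fun _ => K)) :=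
          ⟨fun i => (x i).out, funext fun i => ((x i).out_eq).symm⟩
        refine (Ultraproduct.funMap_cast (u := U) f y).trans ?_
        cases f <;> rfl
      map_rel' := fun {n} r => by cases r }
  exact StrongHomClass.realize_formula e φ

/-- The diagonal embedding of a ring into its ring of germs. -/
def Filter.Germ.diag {ι : Type*} (l : Filter ι) (K : Type*) [Ring K] : K →+* Germ l K where
  toFun x := (x : Germ l K)
  map_one' := rfl
  map_mul' _ _ := rfl
  map_zero' := rfl
  map_add' _ _ := rfl

theorem Filter.Germ.isElementaryRingHom_diag {ι K : Type*} [Field K] (U : Ultrafilter ι) :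
    IsElementaryRingHom (Germ.diag (U : Filter ι) K) := by
  intro n φ v
  exact (Germ.realize_formula U φ fun b _ => v b).trans eventually_const

theorem RingElemEquiv.exists_isElementaryRingHom_germ {A B : Type u} [Field A] [Field B]
    (h : RingElemEquiv A B) :
    ∃ (ι : Type u) (U : Ultrafilter ι) (f : A →+* Germ (U : Filter ι) B),
      IsElementaryRingHom f := by
  classical
  have key : ∀ φ : Language.ring.Formula A, φ.Realize (fun a => a) →
      ∃ b : A → B, φ.Realize b := by
    intro φ hφ
    have hA : φ.exClosure.Realize A :=
      (Formula.realize_exClosure φ).2 ⟨fun a => a,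
        (BoundedFormula.realize_restrictFreeVar (fun a => a) fun _ => rfl).2 hφ⟩
    have hB : φ.exClosure.Realize B := ((elementarilyEquivalent_iff.1 h) _).1 hA
    obtain ⟨b, hb⟩ := (Formula.realize_exClosure φ).1 hB
    refine ⟨fun a => if ha : a ∈ φ.freeVarFinset then b ⟨a, ha⟩ else 0, ?_⟩
    exact (BoundedFormula.realize_restrictFreeVar _ fun a => by simp).1 hb
  have fin : ∀ s : Finset (Language.ring.Formula A), ∃ b : A → B,
      ∀ φ ∈ s, φ.Realize (fun a => a) → φ.Realize b := by
    intro s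
    let t : Finset (Language.ring.Formula A) := s.filter fun φ => φ.Realize fun a => a
    obtain ⟨b, hb⟩ := key (Formula.iInf fun φ : t => φ.1)
      (Formula.realize_iInf.2 fun φ => (Finset.mem_filter.1 φ.2).2)
    exact ⟨b, fun φ hφ hr => Formula.realize_iInf.1 hb ⟨φ, Finset.mem_filter.2 ⟨hφ, hr⟩⟩⟩
  choose b hb using fin
  let U : Ultrafilter (Finset (Language.ring.Formula A)) := Ultrafilter.of atTop
  let f : A → Germ (U : Filter (Finset (Language.ring.Formula A))) B :=
    fun a => Germ.ofFun fun s => b s a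
  have hf : ∀ φ : Language.ring.Formula A, φ.Realize (fun a => a) → φ.Realize f := by
    intro φ hφ
    refine (Germ.realize_formula U φ fun a s => b s a).2 ?_
    have : ∀ᶠ s in (atTop : Filter (Finset (Language.ring.Formula A))), {φ} ≤ s :=
      eventually_ge_atTop _
    filter_upwards [Ultrafilter.of_le atTop this] with s hs
    exact hb s φ (hs (Finset.mem_singleton_self φ)) hφ
  have hf' : ∀ n (φ : Language.ring.Formula (Fin n)) (v : Fin n → A),
      φ.Realize (f ∘ v) ↔ φ.Realize v := by
    intro n φ v
    refine ⟨fun h1 => ?_, fun h1 => ?_⟩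
    · by_contra h2
      have := hf (φ.not.relabel v) (Formula.realize_relabel.2 (Formula.realize_not.2 h2))
      exact Formula.realize_not.1 (Formula.realize_relabel.1 this) h1
    · exact Formula.realize_relabel.1 (hf (φ.relabel v) (Formula.realize_relabel.2 h1))
  let F : A ↪ₑ[Language.ring] Germ (U : Filter (Finset (Language.ring.Formula A))) B := ⟨f, hf'⟩
  refine ⟨_, U, ⟨⟨⟨F, ?_⟩, ?_⟩, ?_, ?_⟩, hf'⟩
  · simpa using F.map_fun oneFunc ![]
  · intro x y
    simpa using F.map_fun mulFunc ![x, y]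
  · simpa using F.map_fun zeroFunc ![]
  · intro x y
    simpa using F.map_fun addFunc ![x, y]

namespace DirectLimit

variable {ι : Type*} [Preorder ι] [IsDirectedOrder ι] [Nonempty ι] {G : ι → Type*}
  [∀ i, Field (G i)] (f : ∀ i j, i ≤ j → G i →+* G j) [DirectedSystem G (f · · ·)]

/-- The canonical ring homomorphism into the direct limit of a directed system of fields. -/
def fieldOf (i : ι) : G i →+* DirectLimit G f where
  toFun x := ⟦⟨i, x⟩⟧
  map_one' := (one_def i).symm
  map_mul' x y := (mul_def i x y).symm
  map_zero' := (zero_def i).symm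
  map_add' x y := (add_def i x y).symm

theorem fieldOf_comp {i j : ι} (h : i ≤ j) (x : G i) : fieldOf f j (f i j h x) = fieldOf f i x :=
  mk_apply i j x h

theorem isElementaryRingHom_fieldOf (hf : ∀ i j h, IsElementaryRingHom (f i j h)) (i : ι) :
    IsElementaryRingHom (fieldOf f i) := by
  suffices H : ∀ (α : Type) (n : ℕ) (φ : Language.ring.BoundedFormula α n) (i : ι) (v : α → G i)
      (xs : Fin n → G i),
      φ.Realize (fieldOf f i ∘ v) (fieldOf f i ∘ xs) ↔ φ.Realize v xs by
    intro n φ v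
    refine Iff.trans ?_ (H _ _ φ i v default)
    rw [Unique.eq_default (fieldOf f i ∘ default)]
    rfl
  intro α n φ
  induction φ with
  | falsum => exact fun _ _ _ => Iff.rfl
  | equal t₁ t₂ =>
    intro i v xs
    simp only [BoundedFormula.Realize, ← Sum.comp_elim, RingHom.realize_term]
    exact (fieldOf f i).injective.eq_iff
  | rel r => exact r.elim
  | imp _ _ ih₁ ih₂ =>
    intro i v xs
    simp only [BoundedFormula.Realize, ih₁, ih₂]
  | @all n φ ih =>
    intro i v xs
    have comp_eq : ∀ {β : Type} {j} (h : i ≤ j) (w : β → G i),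
        fieldOf f j ∘ f i j h ∘ w = fieldOf f i ∘ w :=
      fun h w => funext fun _ => fieldOf_comp f h _
    refine ⟨fun H x => ?_, fun H y => ?_⟩
    · rw [← ih i, Fin.comp_snoc]
      exact H _
    · obtain ⟨k, x, rfl⟩ := exists_eq_mk f y
      obtain ⟨j, hij, hkj⟩ := exists_ge_ge i k
      have hj := ((hf i j hij).realize_boundedFormula φ.all v xs).2 H (f k j hkj x)
      rw [← ih j, Fin.comp_snoc, comp_eq, comp_eq, fieldOf_comp] at hj
      exact hj

end DirectLimit

end ElementaryRingHom

/-- `g` restricts on `O` to a ring homomorphism inducing an embedding of the residue field of the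
nontrivial valuation ring `O` of `K` into `L`. -/
structure IsResidueMap {K L : Type*} [Field K] [Field L] (O : Set K) (g : K → L) : Prop where
  add_mem : ∀ x ∈ O, ∀ y ∈ O, x + y ∈ O
  mul_mem : ∀ x ∈ O, ∀ y ∈ O, x * y ∈ O
  neg_mem : ∀ x ∈ O, -x ∈ O
  mem_or_inv_mem : ∀ x, x ∈ O ∨ x⁻¹ ∈ O
  exists_notMem : ∃ x, x ∉ O
  map_one : g 1 = 1
  map_add : ∀ x ∈ O, ∀ y ∈ O, g (x + y) = g x + g y
  map_mul : ∀ x ∈ O, ∀ y ∈ O, g (x * y) = g x * g y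
  inv_mem : ∀ x ∈ O, g x ≠ 0 → x⁻¹ ∈ O

namespace IsResidueMap

variable {K L : Type*} [Field K] [Field L] {O : Set K} {g : K → L}

theorem one_mem (h : IsResidueMap O g) : 1 ∈ O := by
  simpa using h.mem_or_inv_mem 1

theorem zero_mem (h : IsResidueMap O g) : 0 ∈ O := by
  simpa using h.mem_or_inv_mem 0

theorem map_zero (h : IsResidueMap O g) : g 0 = 0 := by
  simpa using h.map_add 0 h.zero_mem 0 h.zero_mem

/-- The valuation ring on which a residue map is defined. -/
def valuationSubring (h : IsResidueMap O g) : ValuationSubring K where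
  carrier := O
  mul_mem' := fun hx hy => h.mul_mem _ hx _ hy
  one_mem' := h.one_mem
  add_mem' := fun hx hy => h.add_mem _ hx _ hy
  zero_mem' := h.zero_mem
  neg_mem' := fun hx => h.neg_mem _ hx
  mem_or_inv_mem' := h.mem_or_inv_mem

theorem valuationSubring_ne_top (h : IsResidueMap O g) : h.valuationSubring ≠ ⊤ := by
  obtain ⟨x, hx⟩ := h.exists_notMem
  intro e
  have : x ∈ h.valuationSubring := e ▸ ValuationSubring.mem_top x
  exact hx this

/-- The restriction of a residue map to its valuation ring. -/
def toRingHom (h : IsResidueMap O g) : h.valuationSubring →+* L where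
  toFun x := g x
  map_one' := h.map_one
  map_mul' x y := h.map_mul x x.2 y y.2
  map_zero' := h.map_zero
  map_add' x y := h.map_add x x.2 y y.2

theorem nonempty_residueField_ringHom (h : IsResidueMap O g) :
    Nonempty (IsLocalRing.ResidueField h.valuationSubring →+* L) := by
  have : IsLocalHom h.toRingHom := by
    refine ⟨fun x hx => ?_⟩
    have hx0 : g x ≠ 0 := hx.ne_zero
    have hx1 : (x : K) ≠ 0 := fun e => hx0 (e ▸ h.map_zero)
    refine IsUnit.of_mul_eq_one ⟨(x : K)⁻¹, h.inv_mem x x.2 hx0⟩ (Subtype.ext ?_)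
    exact mul_inv_cancel₀ hx1
  exact ⟨IsLocalRing.ResidueField.lift h.toRingHom⟩

theorem _root_.ValuationSubring.exists_isResidueMap (A : ValuationSubring K) (hA : A ≠ ⊤)
    (e : IsLocalRing.ResidueField A →+* L) : ∃ g : K → L, IsResidueMap (A : Set K) g := by
  classical
  let g : K → L := fun x => if hx : x ∈ A then e (IsLocalRing.residue A ⟨x, hx⟩) else 0
  have hg : ∀ x (hx : x ∈ A), g x = e (IsLocalRing.residue A ⟨x, hx⟩) := fun x hx => dif_pos hx
  refine ⟨g, fun x hx y hy => A.add_mem _ _ hx hy, fun x hx y hy => A.mul_mem _ _ hx hy,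
    fun x hx => A.neg_mem _ hx, A.mem_or_inv_mem, ?_, ?_, ?_, ?_, ?_⟩
  · by_contra! H
    exact hA (eq_top_iff.2 fun x _ => H x)
  · rw [hg 1 A.one_mem]
    exact (congrArg e (_root_.map_one _)).trans (_root_.map_one e)
  · intro x hx y hy
    rw [hg x hx, hg y hy, hg (x + y) (A.add_mem _ _ hx hy), ← _root_.map_add, ← _root_.map_add]
    rfl
  · intro x hx y hy
    rw [hg x hx, hg y hy, hg (x * y) (A.mul_mem _ _ hx hy), ← _root_.map_mul, ← _root_.map_mul]
    rfl
  · intro x hx h0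
    rw [hg x hx] at h0
    have h1 : IsUnit (⟨x, hx⟩ : A) := by
      rw [← IsLocalRing.residue_ne_zero_iff_isUnit]
      exact fun h => h0 (by rw [h, _root_.map_zero])
    obtain ⟨y, hy⟩ := h1.exists_right_inv
    have : x * y = 1 := congrArg Subtype.val hy
    rw [inv_eq_of_mul_eq_one_right this]
    exact y.2

theorem germ {ι : Type*} (U : Ultrafilter ι) (h : IsResidueMap O g) :
    IsResidueMap {x : Germ (U : Filter ι) K | x.LiftPred (· ∈ O)} (Germ.map g) where
  add_mem x hx y hy := by
    induction x, y using Germ.inductionOn₂ with | _ x y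
    filter_upwards [hx, hy] with i hx hy using h.add_mem _ hx _ hy
  mul_mem x hx y hy := by
    induction x, y using Germ.inductionOn₂ with | _ x y
    filter_upwards [hx, hy] with i hx hy using h.mul_mem _ hx _ hy
  neg_mem x hx := by
    induction x using Germ.inductionOn with | _ x
    filter_upwards [hx] with i hx using h.neg_mem _ hx
  mem_or_inv_mem x := by
    induction x using Germ.inductionOn with | _ x
    exact Ultrafilter.eventually_or.1 (Eventually.of_forall fun i => h.mem_or_inv_mem (x i))
  exists_notMem := by
    obtain ⟨x, hx⟩ := h.exists_notMem
    exact ⟨(x : Germ (U : Filter ι) K), fun H => hx (Germ.liftPred_const_iff.1 H)⟩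
  map_one := congrArg (fun z : L => (z : Germ (U : Filter ι) L)) h.map_one
  map_add x hx y hy := by
    induction x, y using Germ.inductionOn₂ with | _ x y
    refine Germ.coe_eq.2 ?_
    filter_upwards [hx, hy] with i hx hy using h.map_add _ hx _ hy
  map_mul x hx y hy := by
    induction x, y using Germ.inductionOn₂ with | _ x y
    refine Germ.coe_eq.2 ?_
    filter_upwards [hx, hy] with i hx hy using h.map_mul _ hx _ hy
  inv_mem x hx h0 := by
    induction x using Germ.inductionOn with | _ x
    have h1 : ∀ᶠ i in (U : Filter ι), ¬ g (x i) = 0 :=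
      Ultrafilter.eventually_not.2 fun H => h0 (Germ.coe_eq.2 H)
    filter_upwards [hx, h1] with i hx h1 using h.inv_mem _ hx h1

end IsResidueMap

section IterGerm

variable {ι : Type u} (U : Ultrafilter ι) (K : Type u) [Field K]

/-- The iterated ultrapowers of a field. -/
def IterGerm : ℕ → Type u
  | 0 => K
  | n + 1 => Germ (U : Filter ι) (IterGerm n)

noncomputable instance IterGerm.instField : ∀ n, Field (IterGerm U K n)
  | 0 => inferInstanceAs (Field K)
  | n + 1 =>
    letI := IterGerm.instField n
    inferInstanceAs (Field (Germ (U : Filter ι) (IterGerm U K n)))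

namespace IterGerm

/-- The diagonal embedding of an iterated ultrapower into the next one. -/
noncomputable def diag (n : ℕ) : IterGerm U K n →+* IterGerm U K (n + 1) :=
  Germ.diag (U : Filter ι) (IterGerm U K n)

theorem isElementaryRingHom_diag (n : ℕ) : IsElementaryRingHom (diag U K n) :=
  Germ.isElementaryRingHom_diag U

/-- The composite diagonal embeddings between iterated ultrapowers. -/
noncomputable def transition (i j : ℕ) (h : i ≤ j) : IterGerm U K i →+* IterGerm U K j :=
  Nat.leRec (motive := fun j _ => IterGerm U K i →+* IterGerm U K j) (RingHom.id _)
    (fun n _ f => (diag U K n).comp f) h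

theorem transition_self (i : ℕ) : transition U K i i le_rfl = RingHom.id _ :=
  Nat.leRec_self _ _

theorem transition_succ (i j : ℕ) (h : i ≤ j) :
    transition U K i (j + 1) (Nat.le_succ_of_le h) = (diag U K j).comp (transition U K i j h) :=
  Nat.leRec_succ _ _ h

instance : DirectedSystem (IterGerm U K) (transition U K · · ·) where
  map_self i x := by rw [transition_self]; rfl
  map_map k j i hij hjk x := by
    induction k, hjk using Nat.le_induction with
    | base => rw [transition_self]; rfl
    | succ k hjk ih =>
      rw [transition_succ U K j k hjk, transition_succ U K i k (hij.trans hjk)]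
      exact congrArg (diag U K k) ih

theorem isElementaryRingHom_transition (i j : ℕ) (h : i ≤ j) :
    IsElementaryRingHom (transition U K i j h) := by
  induction j, h using Nat.le_induction with
  | base => rw [transition_self]; exact IsElementaryRingHom.id
  | succ j h ih =>
    rw [transition_succ U K i j h]
    exact (isElementaryRingHom_diag U K j).comp ih

variable {K}

/-- The sets of germs induced on the iterated ultrapowers by a subset of the field. -/
def carrier (O : Set K) : ∀ n, Set (IterGerm U K n)
  | 0 => O
  | n + 1 => {x : Germ (U : Filter ι) (IterGerm U K n) | x.LiftPred (· ∈ carrier O n)}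

/-- The maps induced on the iterated ultrapowers by a map from a field to its ultrapower. -/
def residue (g : K → Germ (U : Filter ι) K) : ∀ n, IterGerm U K n → IterGerm U K (n + 1)
  | 0 => g
  | n + 1 => Germ.map (residue g n)

theorem isResidueMap {O : Set K} {g : K → Germ (U : Filter ι) K} (h : IsResidueMap O g) :
    ∀ n, IsResidueMap (carrier U O n) (residue U g n)
  | 0 => h
  | n + 1 => (isResidueMap h n).germ U

theorem diag_mem_carrier (O : Set K) (n : ℕ) (x : IterGerm U K n) :
    diag U K n x ∈ carrier U O (n + 1) ↔ x ∈ carrier U O n :=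
  Germ.liftPred_const_iff

theorem residue_diag (g : K → Germ (U : Filter ι) K) (n : ℕ) (x : IterGerm U K n) :
    residue U g (n + 1) (diag U K n x) = diag U K (n + 1) (residue U g n x) :=
  rfl

theorem transition_mem_carrier (O : Set K) {i j : ℕ} (h : i ≤ j) (x : IterGerm U K i) :
    transition U K i j h x ∈ carrier U O j ↔ x ∈ carrier U O i := by
  induction j, h using Nat.le_induction with
  | base => rw [transition_self]; rfl
  | succ j h ih =>
    rw [transition_succ U K i j h]
    exact (diag_mem_carrier U O j _).trans ih

theorem residue_transition (g : K → Germ (U : Filter ι) K) {i j : ℕ} (h : i ≤ j)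
    (x : IterGerm U K i) :
    residue U g j (transition U K i j h x) =
      transition U K (i + 1) (j + 1) (Nat.succ_le_succ h) (residue U g i x) := by
  induction j, h using Nat.le_induction with
  | base => rw [transition_self, transition_self]; rfl
  | succ j h ih =>
    rw [transition_succ U K i j h, transition_succ U K (i + 1) (j + 1) (Nat.succ_le_succ h)]
    exact (residue_diag U g j _).trans (congrArg (diag U K (j + 1)) ih)

variable (K) in
/-- The direct limit of the iterated ultrapowers of a field. -/
abbrev Limit : Type u := DirectLimit (IterGerm U K) (transition U K)

/-- The canonical map of an iterated ultrapower into the limit. -/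
noncomputable abbrev of (n : ℕ) : IterGerm U K n →+* Limit U K :=
  DirectLimit.fieldOf (transition U K) n

/-- The subset of the limit of iterated ultrapowers induced by a subset of the field. -/
def limitCarrier (O : Set K) : Set (Limit U K) :=
  fun z => DirectLimit.lift (transition U K) (fun n x => x ∈ carrier U O n)
    (fun _ _ h x => propext (transition_mem_carrier U O h x).symm) z

/-- The self-map of the limit of iterated ultrapowers induced by a map to the ultrapower. -/
noncomputable def limitResidue (g : K → Germ (U : Filter ι) K) : Limit U K → Limit U K :=
  DirectLimit.lift (transition U K) (fun n x => of U (n + 1) (residue U g n x))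
    (fun _ _ h x => by
      rw [residue_transition U g h x]
      exact (DirectLimit.fieldOf_comp _ _ _).symm)

theorem isResidueMap_limit {O : Set K} {g : K → Germ (U : Filter ι) K} (h : IsResidueMap O g) :
    IsResidueMap (limitCarrier U O) (limitResidue U g) := by
  have hO : ∀ n x, of U n x ∈ limitCarrier U O ↔ x ∈ carrier U O n := fun _ _ => Iff.rfl
  have hg : ∀ n x, limitResidue U g (of U n x) = of U (n + 1) (residue U g n x) :=
    fun _ _ => rfl
  have hn := isResidueMap U h
  have ex : ∀ z : Limit U K, ∃ n x, z = of U n x := DirectLimit.exists_eq_mk _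
  have ex₂ : ∀ z w : Limit U K, ∃ n x y, z = of U n x ∧ w = of U n y :=
    DirectLimit.exists_eq_mk₂ _
  constructor
  · intro z hz w hw
    obtain ⟨n, x, y, rfl, rfl⟩ := ex₂ z w
    rw [← map_add, hO]
    exact (hn n).add_mem x hz y hw
  · intro z hz w hw
    obtain ⟨n, x, y, rfl, rfl⟩ := ex₂ z w
    rw [← map_mul, hO]
    exact (hn n).mul_mem x hz y hw
  · intro z hz
    obtain ⟨n, x, rfl⟩ := ex z
    rw [← map_neg, hO]
    exact (hn n).neg_mem x hz
  · intro z
    obtain ⟨n, x, rfl⟩ := ex z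
    rw [← map_inv₀, hO, hO]
    exact (hn n).mem_or_inv_mem x
  · obtain ⟨x, hx⟩ := h.exists_notMem
    exact ⟨of U 0 x, hx⟩
  · rw [← map_one (of U 0), hg, (hn 0).map_one, map_one, map_one]
  · intro z hz w hw
    obtain ⟨n, x, y, rfl, rfl⟩ := ex₂ z w
    rw [← map_add, hg, hg, hg, (hn n).map_add x hz y hw, map_add]
  · intro z hz w hw
    obtain ⟨n, x, y, rfl, rfl⟩ := ex₂ z w
    rw [← map_mul, hg, hg, hg, (hn n).map_mul x hz y hw, map_mul]
  · intro z hz h0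
    obtain ⟨n, x, rfl⟩ := ex z
    rw [← map_inv₀, hO]
    refine (hn n).inv_mem x hz fun e => h0 ?_
    rw [hg, e, map_zero]

end IterGerm

end IterGerm

theorem HasEmbeddedResidue.exists_elementary_extension {F : Type u} [Field F]
    (h : HasEmbeddedResidue F) :
    ∃ (Fs : Type u) (i : Field Fs),
      letI := i
      ∃ f : F →+* Fs, IsElementaryRingHom f ∧
        ∃ O : ValuationSubring Fs, O ≠ ⊤ ∧
          Nonempty (IsLocalRing.ResidueField ↥O →+* Fs) := by
  obtain ⟨F₁, i₁, F₂, i₂, h₁, h₂, A, hA, ⟨e⟩⟩ := h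
  obtain ⟨ι, U, f, -⟩ := (h₂.symm.trans h₁).exists_isElementaryRingHom_germ
  obtain ⟨g, hg⟩ := A.exists_isResidueMap hA (f.comp e)
  have hL : IsElementaryRingHom (IterGerm.of (K := F₁) U 0) :=
    DirectLimit.isElementaryRingHom_fieldOf _ (IterGerm.isElementaryRingHom_transition U F₁) 0
  obtain ⟨κ, V, f', hf'⟩ := (h₁.trans hL.ringElemEquiv).exists_isElementaryRingHom_germ
  have hr := (IterGerm.isResidueMap_limit U hg).germ V
  exact ⟨_, inferInstance, f', hf', hr.valuationSubring, hr.valuationSubring_ne_top,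
    hr.nonempty_residueField_ringHom⟩

/-- A field has embedded residue iff some elementary extension `F ⪯ F*` carries a nontrivial
valuation whose residue field embeds into `F*`. -/
theorem stmt_12 (F : Type u) [Field F] :
    HasEmbeddedResidue F ↔
      ∃ (Fs : Type u) (i : Field Fs),
        letI := i
        ∃ f : F →+* Fs, IsElementaryRingHom f ∧
          ∃ O : ValuationSubring Fs, O ≠ ⊤ ∧
            Nonempty (IsLocalRing.ResidueField ↥O →+* Fs) := by
  refine ⟨fun h => h.exists_elementary_extension, ?_⟩
  rintro ⟨Fs, i, f, hf, h⟩
  exact ⟨Fs, i, Fs, i, hf.ringElemEquiv, hf.ringElemEquiv, h⟩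
end

section
/- Let $F$ be a field. Then $F$ is existentially closed in the Laurent series field $F((t))$ if and only if $F$ is existentially closed in the henselization $F(t)^h$ of the rational function field $F(t)$ with respect to the $t$-adic valuation. -/
open Multiplicative

/-- `f : F → L` is existentially closed: every finite system of polynomial equations and
inequations over `F` with a solution in `L` has a solution in `F`. -/
def ExistClosedAlong {F L : Type*} [Field F] [Field L] (f : F →+* L) : Prop :=
  ∀ (n : ℕ) (S T : Finset (MvPolynomial (Fin n) F)),
    (∃ x : Fin n → L, (∀ q ∈ S, MvPolynomial.eval₂ f x q = 0) ∧
      (∀ q ∈ T, MvPolynomial.eval₂ f x q ≠ 0)) →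
    ∃ x : Fin n → F, (∀ q ∈ S, MvPolynomial.eval x q = 0) ∧
      (∀ q ∈ T, MvPolynomial.eval x q ≠ 0)

/-- The henselization of `F(t)` with respect to the `t`-adic valuation, realized inside `F((t))`
as the intersection of all subfields containing `F` and `t` on which the restricted valuation is
henselian. -/
noncomputable def tAdicHenselization (F : Type*) [Field F] : Subfield (LaurentSeries F) :=
  sInf {M : Subfield (LaurentSeries F) |
    (∀ c : F, algebraMap F (LaurentSeries F) c ∈ M) ∧
    HahnSeries.single (1 : ℤ) (1 : F) ∈ M ∧
    HenselianLocalRing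
      ↥((Valued.v.valuationSubring : ValuationSubring (LaurentSeries F)).comap M.subtype)}

/-- The natural map `F → F(t)ʰ`. -/
noncomputable def toTAdicHenselization (F : Type*) [Field F] : F →+* ↥(tAdicHenselization F) :=
  (algebraMap F (LaurentSeries F)).codRestrict (tAdicHenselization F).toSubring
    (fun c => Subfield.mem_sInf.mpr fun _ hM => hM.1 c)

universe u v w x

/-- In a local ring, an element congruent to a unit modulo the maximal ideal is a unit. -/
theorem IsLocalRing.isUnit_of_sub_mem_maximalIdeal {R : Type*} [CommRing R] [IsLocalRing R]
    {x y : R} (hx : IsUnit x) (hxy : y - x ∈ IsLocalRing.maximalIdeal R) : IsUnit y := by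
  by_contra hn
  have := sub_mem ((IsLocalRing.mem_maximalIdeal _).2 hn) hxy
  rw [sub_sub_cancel] at this
  exact this hx

open Polynomial in
/-- In a henselian local ring, a polynomial with linear coefficient `1` and constant coefficient
in the maximal ideal has a root in the maximal ideal; it need not be monic. -/
theorem HenselianLocalRing.exists_isRoot_mem_maximalIdeal {R : Type*} [CommRing R]
    [HenselianLocalRing R] {Q : R[X]} (h₀ : Q.coeff 0 ∈ IsLocalRing.maximalIdeal R)
    (h₁ : Q.coeff 1 = 1) : ∃ z ∈ IsLocalRing.maximalIdeal R, Q.IsRoot z := by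
  set e := Q.coeff 0
  set W := Q.divX.divX
  set N := W.natDegree
  have hQ : Q = (W * X + 1) * X + C e := by
    have h : Q.divX = W * X + 1 := by
      rw [← Q.divX.divX_mul_X_add, coeff_divX, zero_add, h₁, C_1]
    rw [← h, divX_mul_X_add]
  set H : R[X] := ∑ k ∈ Finset.range (N + 1), C (W.coeff k * (-e) ^ k) * X ^ (N - k) with hH
  have hHdeg : H.natDegree ≤ N :=
    natDegree_sum_le_of_forall_le _ _ fun k _ =>
      (natDegree_C_mul_X_pow_le _ _).trans (Nat.sub_le _ _)
  have hmonic : (X ^ (N + 2) + (C e * H - X ^ (N + 1))).Monic := by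
    refine monic_X_pow_add (lt_of_le_of_lt (b := ((N + 1 : ℕ) : WithBot ℕ)) ?_
      (by exact_mod_cast Nat.lt_succ_self _))
    refine natDegree_le_iff_degree_le.mp ((natDegree_sub_le _ _).trans (max_le ?_ ?_))
    · exact ((natDegree_C_mul_le _ _).trans hHdeg).trans (Nat.le_succ _)
    · exact natDegree_X_pow_le _
  obtain ⟨u, hu, hu1⟩ := HenselianLocalRing.is_henselian _ hmonic 1
    (by simpa using Ideal.mul_mem_right _ _ h₀)
    (by
      have : (derivative (X ^ (N + 2) + (C e * H - X ^ (N + 1)))).eval 1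
          = 1 + e * (derivative H).eval 1 := by
        simp
        ring
      rw [this]
      refine IsLocalRing.isUnit_of_sub_mem_maximalIdeal isUnit_one ?_
      simpa using Ideal.mul_mem_right _ _ h₀)
  have hunit : IsUnit u := IsLocalRing.isUnit_of_sub_mem_maximalIdeal isUnit_one hu1
  obtain ⟨v, huv⟩ := hunit.exists_right_inv
  refine ⟨-e * v, Ideal.mul_mem_right _ _ (neg_mem h₀), ?_⟩
  have hW : u ^ N * W.eval (-e * v) = H.eval u := by
    rw [eval_eq_sum_range, hH, eval_finsetSum, Finset.mul_sum]
    refine Finset.sum_congr rfl fun k hk => ?_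
    obtain ⟨j, hj⟩ := Nat.exists_eq_add_of_le (Nat.lt_succ_iff.mp (Finset.mem_range.mp hk))
    have : u ^ k * v ^ k = 1 := by rw [← mul_pow, huv, one_pow]
    simp only [eval_mul, eval_C, eval_pow, eval_X, mul_pow]
    change _ = W.coeff k * (-e) ^ k * u ^ (N - k)
    rw [hj, Nat.add_sub_cancel_left, pow_add]
    linear_combination (u ^ j * W.coeff k * (-e) ^ k) * this
  have hroot : u ^ (N + 2) + (e * H.eval u - u ^ (N + 1)) = 0 := by
    simpa [IsRoot] using hu
  have key : u ^ (N + 2) * Q.eval (-e * v) = 0 := by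
    rw [hQ]
    simp only [eval_add, eval_mul, eval_X, eval_C, eval_one]
    linear_combination e * hroot + e ^ 2 * u ^ 2 * v ^ 2 * hW +
      (e ^ 2 * (u * v + 1) * H.eval u - e * u ^ (N + 1)) * huv
  exact ((hunit.pow _).mul_right_eq_zero).mp key

open Polynomial in
/-- Two congruent roots of a polynomial over a local ring coincide when they are simple. -/
theorem IsLocalRing.eq_of_isRoot_of_sub_mem_maximalIdeal {R : Type*} [CommRing R] [IsLocalRing R]
    {Q : R[X]} {x y : R} (hx : Q.IsRoot x) (hy : Q.IsRoot y)
    (hxy : y - x ∈ IsLocalRing.maximalIdeal R) (hQ : IsUnit (Q.derivative.eval x)) : x = y := by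
  obtain ⟨k, hk⟩ := Q.binomExpansion x (y - x)
  rw [add_sub_cancel, hx.eq_zero, hy.eq_zero] at hk
  have hunit : IsUnit (Q.derivative.eval x + k * (y - x)) :=
    isUnit_of_sub_mem_maximalIdeal hQ (by simpa using Ideal.mul_mem_left _ k hxy)
  refine (sub_eq_zero.mp (hunit.mul_right_eq_zero.mp ?_)).symm
  linear_combination -hk

theorem ValuationSubring.isLocalHom_comap_restrict {K L : Type*} [Field K] [Field L]
    (A : ValuationSubring L) (g : K →+* L) (h : (A.comap g).toSubring ≤ A.toSubring.comap g) :
    IsLocalHom (g.restrict (A.comap g).toSubring A.toSubring h) where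
  map_nonunit a ha := by
    obtain ⟨b, hb⟩ := ha.exists_right_inv
    have hab : g a * b = 1 := congr_arg Subtype.val hb
    have ha0 : (a : K) ≠ 0 := fun h0 => by simp [h0] at hab
    refine IsUnit.of_mul_eq_one ⟨(a : K)⁻¹, ?_⟩ (Subtype.ext (mul_inv_cancel₀ ha0))
    change g (a : K)⁻¹ ∈ A
    rw [map_inv₀, inv_eq_of_mul_eq_one_right hab]
    exact b.2

open IsLocalRing Polynomial in
/-- An intersection of subfields on which a valuation ring is henselian has this property. -/
theorem ValuationSubring.henselianLocalRing_comap_sInf {L : Type*} [Field L]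
    (A : ValuationSubring L) {S : Set (Subfield L)} (hS : S.Nonempty)
    (h : ∀ M ∈ S, HenselianLocalRing (A.comap M.subtype)) :
    HenselianLocalRing (A.comap (sInf S).subtype) where
  is_henselian f hf a₀ ha hu := by
    let j (M : Subfield L) : A.comap M.subtype →+* A :=
      M.subtype.restrict (A.comap M.subtype).toSubring A.toSubring fun _ hx => hx
    let i (M : Subfield L) (hM : M ∈ S) : A.comap (sInf S).subtype →+* A.comap M.subtype :=
      (Subfield.inclusion (sInf_le hM)).restrict (A.comap (sInf S).subtype).toSubring
        (A.comap M.subtype).toSubring fun _ hx => hx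
    have hj (M : Subfield L) : IsLocalHom (j M) := A.isLocalHom_comap_restrict M.subtype _
    have hji (M : Subfield L) (hM : M ∈ S) : (j M).comp (i M hM) = j (sInf S) := rfl
    have hi (M : Subfield L) (hM : M ∈ S) : IsLocalHom (i M hM) :=
      have : IsLocalHom ((j M).comp (i M hM)) := hj (sInf S)
      isLocalHom_of_comp (i M hM) (j M)
    have root (M : Subfield L) (hM : M ∈ S) : ∃ a : A.comap M.subtype,
        (f.map (j (sInf S))).IsRoot (j M a) ∧ j M a - j (sInf S) a₀ ∈ maximalIdeal A := by
      have := h M hM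
      have := hi M hM
      obtain ⟨a, ha, ha'⟩ := HenselianLocalRing.is_henselian (f.map (i M hM)) (hf.map _)
        (i M hM a₀)
        (by rw [eval_map_apply]; exact map_nonunit _ _ ha)
        (by rw [derivative_map, eval_map_apply]; exact hu.map _)
      refine ⟨a, ?_, ?_⟩
      · rw [← hji M hM, ← Polynomial.map_map]
        exact ha.map
      · rw [← hji M hM, RingHom.comp_apply, ← map_sub]
        exact map_nonunit _ _ ha'
    obtain ⟨M₀, hM₀⟩ := hS
    obtain ⟨a, ha, ha'⟩ := root M₀ hM₀
    have hmem : (j M₀ a : L) ∈ sInf S := Subfield.mem_sInf.mpr fun M hM => by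
      obtain ⟨b, hb, hb'⟩ := root M hM
      have hab : j M₀ a = j M b := by
        refine eq_of_isRoot_of_sub_mem_maximalIdeal ha hb (by simpa using sub_mem hb' ha') ?_
        refine isUnit_of_sub_mem_maximalIdeal (hu.map (j (sInf S))) ?_
        rw [← eval_map_apply, ← derivative_map]
        exact Ideal.mem_of_dvd _ (sub_dvd_eval_sub _ _ _) ha'
      rw [hab]
      exact b.1.2
    let c : A.comap (sInf S).subtype := ⟨⟨j M₀ a, hmem⟩, (j M₀ a).2⟩
    have hjc : j (sInf S) c = j M₀ a := rfl
    have hinj : Function.Injective (j (sInf S)) := fun x y hxy =>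
      Subtype.ext (Subtype.ext (congr_arg (Subtype.val : A → L) hxy :))
    have := hj (sInf S)
    refine ⟨c, ?_, ?_⟩
    · rw [← hjc] at ha
      exact ha.of_map hinj
    · rw [← hjc, ← map_sub] at ha'
      exact fun hn => ha' (hn.map _)

/-- Frobenius on power series raises the coefficients to the `p`-th power. -/
theorem PowerSeries.coeff_mul_pow_expChar {F : Type*} [CommRing F] (p : ℕ) [ExpChar F p]
    (f : PowerSeries F) (n : ℕ) :
    PowerSeries.coeff (p * n) (f ^ p) = (PowerSeries.coeff n f) ^ p := by
  have h : PowerSeries.map (frobenius F p) (f.expand p (expChar_ne_zero F p)) = f ^ p :=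
    MvPowerSeries.map_frobenius_expand p (expChar_ne_zero F p)
  rw [← h, PowerSeries.coeff_map, PowerSeries.coeff_expand_mul, frobenius_def]

theorem PowerSeries.linearIndependent_pow_expChar {F ι : Type*} [Field F] [Finite ι] (p : ℕ)
    [ExpChar F p] {f : ι → PowerSeries F} (hf : LinearIndependent F f) :
    LinearIndependent F (fun i => f i ^ p) := by
  classical
  have := Fintype.ofFinite ι
  rw [Fintype.linearIndependent_iff] at hf ⊢
  intro g hg i
  have hspan : Submodule.span F (Set.range fun n j => PowerSeries.coeff n (f j)) = ⊤ := by
    by_contra hne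
    obtain ⟨l, hl0, hl⟩ := Submodule.exists_le_ker_of_lt_top _ (lt_top_iff_ne_top.mpr hne)
    have hlsum (w : ι → F) : l w = ∑ j, l (Pi.single j 1) * w j := by
      conv_lhs => rw [pi_eq_sum_univ' w]
      simp [mul_comm]
    refine hl0 (LinearMap.pi_ext' fun j => LinearMap.ext_ring ?_)
    refine hf (fun j => l (Pi.single j 1)) (PowerSeries.ext fun n => ?_) j
    have := hl (Submodule.subset_span ⟨n, rfl⟩)
    rw [LinearMap.mem_ker, hlsum] at this
    simpa using this
  have key (w : ι → F) : ∑ j, g j * w j ^ p = 0 := by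
    have hw : w ∈ Submodule.span F (Set.range fun n j => PowerSeries.coeff n (f j)) :=
      hspan ▸ Submodule.mem_top
    induction hw using Submodule.span_induction with
    | mem w hw =>
      obtain ⟨n, rfl⟩ := hw
      simpa [PowerSeries.coeff_mul_pow_expChar] using congrArg (PowerSeries.coeff (p * n)) hg
    | zero => simp [expChar_ne_zero F p]
    | add u w _ _ hu hw => simp [add_pow_expChar, mul_add, Finset.sum_add_distrib, hu, hw]
    | smul c w _ hw =>
      simp only [Pi.smul_apply, smul_eq_mul, mul_pow, mul_left_comm _ (c ^ p)]
      rw [← Finset.mul_sum, hw, mul_zero]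
  simpa [Pi.single_apply, ite_pow, expChar_ne_zero F p] using key (Pi.single i 1)

theorem PowerSeries.linearIndependent_pow_expChar_of_isFractionRing {F K ι : Type*} [Field F]
    [Field K] [Algebra F K] [Algebra (PowerSeries F) K] [IsScalarTower F (PowerSeries F) K]
    [IsFractionRing (PowerSeries F) K] [Finite ι] (p : ℕ) [ExpChar F p] {x : ι → K}
    (hx : LinearIndependent F x) : LinearIndependent F (fun i => x i ^ p) := by
  obtain ⟨b, hb⟩ := IsLocalization.exist_integer_multiples_of_finite
    (nonZeroDivisors (PowerSeries F)) x
  choose f hf using hb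
  have hb0 : algebraMap (PowerSeries F) K b ≠ 0 :=
    IsFractionRing.to_map_ne_zero_of_mem_nonZeroDivisors b.2
  let φ : PowerSeries F →ₐ[F] K := IsScalarTower.toAlgHom F (PowerSeries F) K
  have hφ : LinearMap.ker φ.toLinearMap = ⊥ :=
    LinearMap.ker_eq_bot.mpr (IsFractionRing.injective (PowerSeries F) K)
  have hmul (c : K) (hc : c ≠ 0) : LinearMap.ker (LinearMap.mulLeft F c) = ⊥ :=
    LinearMap.ker_eq_bot.mpr (mul_right_injective₀ hc)
  have hfx (i : ι) : φ (f i) = algebraMap (PowerSeries F) K b * x i := by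
    rw [← Algebra.smul_def]
    exact hf i
  have hfl : LinearIndependent F f := by
    rw [← φ.toLinearMap.linearIndependent_iff hφ]
    convert (LinearMap.linearIndependent_iff _ (hmul _ hb0)).mpr hx using 1
    exact funext hfx
  rw [← LinearMap.linearIndependent_iff _ (hmul _ (pow_ne_zero p hb0))]
  convert (φ.toLinearMap.linearIndependent_iff hφ).mpr
    (PowerSeries.linearIndependent_pow_expChar p hfl) using 1
  funext i
  simp [hfx, mul_pow]

open IntermediateField in
/-- Finitely generated subextensions of `F((t))/F` are separably generated. -/
theorem PowerSeries.exists_isTranscendenceBasis_and_isSeparable {F K : Type*} [Field F]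
    [Field K] [Algebra F K] [Algebra (PowerSeries F) K] [IsScalarTower F (PowerSeries F) K]
    [IsFractionRing (PowerSeries F) K] (E : IntermediateField F K) [Algebra.EssFiniteType F E] :
    ∃ s : Finset E, IsTranscendenceBasis F ((↑) : s → E) ∧
      Algebra.IsSeparable (adjoin F (s : Set E)) E := by
  obtain _ | ⟨p, hp, hpF⟩ := CharP.exists' F
  · exact exists_isTranscendenceBasis_and_isSeparable_of_perfectField F E
  have : ExpChar F p := .prime hp.out
  refine exists_isTranscendenceBasis_and_isSeparable_of_linearIndepOn_pow_of_essFiniteType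
    p hp.out fun s hs => ?_
  have hE : LinearMap.ker E.val.toLinearMap = ⊥ :=
    LinearMap.ker_eq_bot.mpr E.val.injective
  exact (LinearMap.linearIndependent_iff _ hE).mp
    (PowerSeries.linearIndependent_pow_expChar_of_isFractionRing p
      ((LinearMap.linearIndependent_iff _ hE).mpr hs))

theorem ValuationSubring.mem_nonunits_comap {K L : Type*} [Field K] [Field L]
    {A : ValuationSubring L} {g : K →+* L} {x : K} :
    x ∈ (A.comap g).nonunits ↔ g x ∈ A.nonunits := by
  simp [mem_nonunits_iff_or]

open Polynomial in
/-- Newton approximation over a field with a henselian valuation ring: if the Taylor expansion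
of `P` at `a` becomes, after rescaling the variable by `c` and normalizing the linear coefficient,
integral with constant term in the maximal ideal, then `P` has a root. -/
theorem ValuationSubring.exists_isRoot_of_henselianLocalRing {K : Type*} [Field K]
    (A : ValuationSubring K) [HenselianLocalRing A] {P : K[X]} {a c : K}
    (hP : P.derivative.eval a * c ≠ 0)
    (h₀ : P.eval a / (P.derivative.eval a * c) ∈ A.nonunits)
    (hA : ∀ k ≤ P.natDegree, (hasseDeriv k P).eval a * c ^ k / (P.derivative.eval a * c) ∈ A) :
    ∃ z, P.IsRoot z := by
  set d := P.derivative.eval a * c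
  set Q : K[X] := C d⁻¹ * ((taylor a P).comp (C c * X)) with hQ
  have hQc (k : ℕ) : Q.coeff k = (hasseDeriv k P).eval a * c ^ k / d := by
    rw [hQ, coeff_C_mul, comp_C_mul_X_coeff, taylor_coeff, div_eq_inv_mul]
  have hQA (k : ℕ) : Q.coeff k ∈ A := by
    rcases le_or_gt k P.natDegree with hk | hk
    · rw [hQc]
      exact hA k hk
    · rw [hQc, hasseDeriv_eq_zero_of_lt_natDegree _ _ hk]
      simp
  obtain ⟨q, hq⟩ : ∃ q : A[X], q.map A.subtype = Q :=
    (mem_lifts _).mp ((lifts_iff_coeff_lifts _).mpr fun k => ⟨⟨_, hQA k⟩, rfl⟩)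
  have hqc (k : ℕ) : (q.coeff k : K) = Q.coeff k := by
    rw [← hq, coeff_map]
    rfl
  obtain ⟨z, -, hz⟩ := HenselianLocalRing.exists_isRoot_mem_maximalIdeal (Q := q)
    (by
      refine (IsLocalRing.mem_maximalIdeal _).2 (ValuationSubring.coe_mem_nonunits_iff.1 ?_)
      rw [hqc, hQc]
      simpa using h₀)
    (Subtype.ext (by
      rw [hqc, hQc, hasseDeriv_one, pow_one]
      exact div_self hP))
  have hzQ : Q.IsRoot z := by
    rw [← hq]
    exact hz.map (f := A.subtype)
  refine ⟨c * z + a, ?_⟩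
  have hd : d⁻¹ ≠ 0 := inv_ne_zero hP
  simpa [hQ, IsRoot, hd, taylor_eval] using hzQ

theorem ValuationSubring.exists_ne_zero_forall_mul_mem {K : Type*} [Field K]
    (A : ValuationSubring K) (s : Finset K) : ∃ c ∈ A, c ≠ 0 ∧ ∀ u ∈ s, c * u ∈ A := by
  obtain ⟨b, hb⟩ := IsLocalization.exist_integer_multiples_of_finset (nonZeroDivisors A) s
  refine ⟨b, (b : A).2, by simp, fun u hu => ?_⟩
  obtain ⟨a, ha⟩ := hb u hu
  have : (a : K) = b * u := ha.trans (Algebra.smul_def _ _)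
  rw [← this]
  exact a.2

theorem Polynomial.continuous_eval₂_eval₂Hom {F L ι : Type*} [CommRing F] [CommRing L]
    [TopologicalSpace L] [IsTopologicalRing L] (e : F →+* L)
    (f : Polynomial (MvPolynomial ι F)) :
    Continuous fun x : (ι → L) × L => f.eval₂ (MvPolynomial.eval₂Hom e x.1) x.2 := by
  have h (p : MvPolynomial ι F) :
      Continuous fun x : (ι → L) × L => MvPolynomial.eval₂Hom e x.1 p := by
    induction p using MvPolynomial.induction_on with
    | C a => simpa using continuous_const
    | add p q hp hq =>
      simp only [map_add]
      exact hp.add hq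
    | mul_X p i hp =>
      simp only [map_mul, MvPolynomial.eval₂Hom_X']
      exact hp.mul ((continuous_apply i).comp continuous_fst)
  simp only [eval₂_eq_sum_range]
  exact continuous_finsetSum _ fun k _ => (h _).mul (continuous_snd.pow k)

theorem Polynomial.map_hasseDeriv {R S : Type*} [Semiring R] [Semiring S] (g : R →+* S) (k : ℕ)
    (p : Polynomial R) : (hasseDeriv k p).map g = hasseDeriv k (p.map g) := by
  ext n
  simp [hasseDeriv_coeff]

open Filter in
/-- Evaluation of polynomials in an ultrapower is computed coordinatewise. -/
theorem MvPolynomial.eval₂Hom_germ {F K J ι : Type*} [CommRing F] [CommRing K] (l : Filter J)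
    (e : F →+* K) (s : J → ι → K) :
    eval₂Hom (((Germ.coeRingHom l).comp (Pi.constRingHom J K)).comp e)
      (fun i => ((fun j => s j i : J → K) : Germ l K)) =
      (Germ.coeRingHom l).comp (RingHom.pi fun j => eval₂Hom e (s j)) := by
  refine MvPolynomial.ringHom_ext (fun a => ?_) fun i => ?_
  · rw [eval₂Hom_C, RingHom.comp_apply, RingHom.comp_apply, RingHom.comp_apply]
    congr 1
    funext j
    exact (eval₂Hom_C e (s j) a).symm
  · rw [eval₂Hom_X', RingHom.comp_apply]
    refine congrArg (Germ.ofFun) ?_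
    funext j
    exact (eval₂Hom_X' e (s j) i).symm

open Filter in
theorem Polynomial.eval₂_germ {F K J ι : Type*} [CommRing F] [CommRing K] (l : Filter J)
    (e : F →+* K) (s : J → ι → K) (y : J → K) (f : Polynomial (MvPolynomial ι F)) :
    f.eval₂ (MvPolynomial.eval₂Hom (((Germ.coeRingHom l).comp (Pi.constRingHom J K)).comp e)
      (fun i => ((fun j => s j i : J → K) : Germ l K))) (y : Germ l K) =
      ((fun j => f.eval₂ (MvPolynomial.eval₂Hom e (s j)) (y j) : J → K) : Germ l K) := by
  rw [MvPolynomial.eval₂Hom_germ]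
  refine (hom_eval₂ f (RingHom.pi fun j => MvPolynomial.eval₂Hom e (s j)) (Germ.coeRingHom l)
    y).symm.trans (congrArg Germ.ofFun ?_)
  funext j
  exact hom_eval₂ f _ (Pi.evalRingHom (fun _ => K) j) y

open Polynomial MvPolynomial Filter Topology in
/-- Let `j : K → L` be a dense embedding of a field with henselian valuation ring. A simple root
`y` in `L` of a polynomial over `F[s]`, with `s` algebraically independent over `F`, deforms into
a root over `F[s']`, with `s'` algebraically independent in an ultrapower of `K`. -/
theorem exists_germ_root_of_denseRange {F : Type u} {K : Type v} {L : Type w} {ι : Type x}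
    [Field F] [Field K] [Field L] [TopologicalSpace L] [IsTopologicalRing L]
    [ContinuousInv₀ L] [T1Space L] {A : ValuationSubring L}
    (hAo : IsOpen (A : Set L)) (hAn : IsOpen (A.nonunits : Set L)) (e : F →+* K) {j : K →+* L}
    (hj : DenseRange j) [HenselianLocalRing (A.comap j)]
    {s : ι → L} (hs : Function.Injective (eval₂Hom (j.comp e) s)) {y : L}
    {f : Polynomial (MvPolynomial ι F)} (hf : f.eval₂ (eval₂Hom (j.comp e) s) y = 0)
    (hf' : f.derivative.eval₂ (eval₂Hom (j.comp e) s) y ≠ 0) :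
    ∃ (U : Ultrafilter ((ι → K) × K × K)) (s' : ι → Germ (U : Filter ((ι → K) × K × K)) K)
      (y' : Germ (U : Filter ((ι → K) × K × K)) K),
      Function.Injective (eval₂Hom (((Germ.coeRingHom (U : Filter ((ι → K) × K × K))).comp
        (Pi.constRingHom _ K)).comp e) s') ∧
      f.eval₂ (eval₂Hom (((Germ.coeRingHom (U : Filter ((ι → K) × K × K))).comp
        (Pi.constRingHom _ K)).comp e) s') y' = 0 := by
  classical
  set D : ℕ → (ι → L) × L × L → L := fun k x =>
    (hasseDeriv k f).eval₂ (eval₂Hom (j.comp e) x.1) x.2.1 with hD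
  have hDc (k : ℕ) : Continuous (D k) :=
    (continuous_eval₂_eval₂Hom (j.comp e) (hasseDeriv k f)).comp
      (continuous_fst.prodMk (continuous_fst.comp continuous_snd))
  obtain ⟨c, hcA, hc, hcD⟩ := A.exists_ne_zero_forall_mul_mem
    ((Finset.range (f.natDegree + 1)).image fun k => D k (s, y, 0) / D 1 (s, y, 0))
  set P : (ι → L) × L × L := (s, y, c) with hP
  have hD1 : D 1 P ≠ 0 := by
    simpa only [hD, hasseDeriv_one] using hf'
  have hD1c : D 1 P * P.2.2 ≠ 0 := mul_ne_zero hD1 hc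
  set φ : (ι → K) × K × K → (ι → L) × L × L := Prod.map (Pi.map fun _ => j) (Prod.map j j) with hφ
  have hφd : DenseRange φ := (DenseRange.piMap fun _ => hj).prodMap (hj.prodMap hj)
  have : (comap φ (𝓝 P)).NeBot :=
    comap_neBot_iff.2 fun t ht => by
      obtain ⟨_, h, a, rfl⟩ := mem_closure_iff_nhds.1 (hφd P) t ht
      exact ⟨a, h⟩
  set U : Ultrafilter ((ι → K) × K × K) := Ultrafilter.of (comap φ (𝓝 P))
  have hU : Tendsto φ U (𝓝 P) := tendsto_iff_comap.2 (Ultrafilter.of_le _)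
  have hne : ∀ᶠ x in 𝓝 P, D 1 x * x.2.2 ≠ 0 :=
    ((hDc 1).mul (continuous_snd.comp continuous_snd)).continuousAt.eventually_ne hD1c
  have hdiv (k m : ℕ) : ContinuousAt (fun x => D k x * x.2.2 ^ m / (D 1 x * x.2.2)) P :=
    ((hDc k).mul ((continuous_snd.comp continuous_snd).pow m)).continuousAt.div
      ((hDc 1).mul (continuous_snd.comp continuous_snd)).continuousAt hD1c
  have h0 : ∀ᶠ x in 𝓝 P, D 0 x * x.2.2 ^ 0 / (D 1 x * x.2.2) ∈ A.nonunits := by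
    refine (hdiv 0 0).eventually_mem (hAn.mem_nhds ?_)
    have : D 0 P = 0 := by simpa only [hD, hasseDeriv_zero'] using hf
    simp [this]
  have hA : ∀ᶠ x in 𝓝 P, ∀ k ∈ Finset.range (f.natDegree + 1),
      D k x * x.2.2 ^ k / (D 1 x * x.2.2) ∈ A := by
    refine (Finset.eventually_all _).2 fun k hk =>
      (hdiv k k).eventually_mem (hAo.mem_nhds ?_)
    have hck : c * (D k P / D 1 P) ∈ A := hcD _ (Finset.mem_image_of_mem _ hk)
    obtain _ | _ | k := k
    · have : D 0 P = 0 := by simpa only [hD, hasseDeriv_zero'] using hf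
      simp [this]
    · simp [div_self hD1c]
    · have : D (k + 2) P * P.2.2 ^ (k + 2) / (D 1 P * P.2.2) = c ^ k * (c * (D (k + 2) P / D 1 P)) := by
        simp only [hP] at hD1 ⊢
        field_simp
        ring
      simpa [this] using mul_mem (pow_mem hcA k) hck
  have hroot : ∀ᶠ x in (U : Filter ((ι → K) × K × K)),
      ∃ z, (f.map (eval₂Hom e x.1)).IsRoot z := by
    filter_upwards [hU.eventually hne, hU.eventually h0, hU.eventually hA] with x hx1 hx0 hxA
    have hDx (k : ℕ) : D k (φ x) = j ((hasseDeriv k (f.map (eval₂Hom e x.1))).eval x.2.1) := by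
      rw [← Polynomial.map_hasseDeriv, Polynomial.eval_map, Polynomial.hom_eval₂]
      simp only [hD]
      congr 1
      exact (MvPolynomial.comp_eval₂Hom _ _ _).symm
    refine (A.comap j).exists_isRoot_of_henselianLocalRing (a := x.2.1) (c := x.2.2) ?_ ?_ ?_
    · rintro h
      refine hx1 ?_
      rw [hDx, hasseDeriv_one]
      exact (map_mul j _ _).symm.trans (by rw [h, map_zero])
    · rw [ValuationSubring.mem_nonunits_comap]
      rw [hDx, hDx, hasseDeriv_one, hasseDeriv_zero'] at hx0
      simpa [hφ] using hx0
    · intro k hk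
      have := hxA k (Finset.mem_range_succ_iff.2 (hk.trans natDegree_map_le))
      rw [hDx, hDx, hasseDeriv_one] at this
      rw [ValuationSubring.mem_comap]
      simpa [hφ] using this
  obtain ⟨z, hz⟩ := hroot.choice
  refine ⟨U, fun i => ((fun x => x.1 i : (ι → K) × K × K → K) : Germ _ K), (z : Germ _ K), ?_, ?_⟩
  · rw [injective_iff_map_eq_zero]
    intro p hp
    by_contra hp0
    rw [MvPolynomial.eval₂Hom_germ _ e (fun x : (ι → K) × K × K => x.1)] at hp
    have hp' : ∀ᶠ x in (U : Filter ((ι → K) × K × K)), eval₂Hom e x.1 p = 0 := Germ.coe_eq.1 hp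
    have hpc : Continuous fun x : (ι → L) × L × L => eval₂Hom (j.comp e) x.1 p := by
      simpa [Function.comp_def] using
        (continuous_eval₂_eval₂Hom (j.comp e) (Polynomial.C p)).comp
          (continuous_fst.prodMk (continuous_fst.comp continuous_snd (Y := L × L)))
    have hps : eval₂Hom (j.comp e) P.1 p ≠ 0 := fun h => hp0 (hs (h.trans (map_zero _).symm))
    obtain ⟨x, hx, hx'⟩ := (hp'.and (hU.eventually (hpc.continuousAt.eventually_ne hps))).exists
    refine hx' ?_
    rw [← map_zero j, ← hx]
    exact (RingHom.congr_fun (MvPolynomial.comp_eval₂Hom _ _ _) p).symm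
  · rw [Polynomial.eval₂_germ _ e (fun x : (ι → K) × K × K => x.1)]
    refine Germ.coe_eq.2 ?_
    filter_upwards [hz] with x hx
    rwa [IsRoot, Polynomial.eval_map] at hx

open Polynomial in
/-- Homomorphisms to a field `K` from a finite separable extension `E` of the fraction field of `R`
are obtained from embeddings `R → K` and roots in `K` of a polynomial over `R` with a simple root
in `E`. -/
theorem IsFractionRing.exists_simple_root_forall_exists_ringHom {R K₁ E : Type*} [CommRing R]
    [Field K₁] [Field E] [Algebra R K₁] [IsFractionRing R K₁] [Algebra K₁ E]
    [FiniteDimensional K₁ E] [Algebra.IsSeparable K₁ E] :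
    ∃ (y : E) (f : R[X]),
      f.eval₂ ((algebraMap K₁ E).comp (algebraMap R K₁)) y = 0 ∧
      f.derivative.eval₂ ((algebraMap K₁ E).comp (algebraMap R K₁)) y ≠ 0 ∧
      ∀ {K : Type w} [Field K] (g : R →+* K) (y' : K), Function.Injective g →
        f.eval₂ g y' = 0 →
        ∃ φ : E →+* K, φ.comp ((algebraMap K₁ E).comp (algebraMap R K₁)) = g := by
  have : IsDomain R := (IsFractionRing.injective R K₁).isDomain
  let pb := Field.powerBasisOfFiniteOfSeparable K₁ E
  obtain ⟨b, hb, hf⟩ := IsLocalization.integerNormalization_spec (nonZeroDivisors R)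
    (minpoly K₁ pb.gen)
  set f := IsLocalization.integerNormalization (nonZeroDivisors R) (minpoly K₁ pb.gen)
  have hb' : algebraMap R K₁ b ≠ 0 := IsFractionRing.to_map_ne_zero_of_mem_nonZeroDivisors hb
  have hf' : f.map (algebraMap R K₁) = C (algebraMap R K₁ b) * minpoly K₁ pb.gen := by
    rw [hf, ← algebraMap_smul K₁ b, smul_eq_C_mul]
  refine ⟨pb.gen, f, ?_, ?_, fun {K} _ g y' hg hy' => ?_⟩
  · rw [← eval₂_map, hf', eval₂_mul, ← aeval_def _ (minpoly _ _), minpoly.aeval, mul_zero]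
  · rw [← eval₂_map, ← derivative_map, hf', derivative_C_mul, eval₂_mul, eval₂_C, ← aeval_def]
    exact mul_ne_zero ((_root_.map_ne_zero _).2 hb')
      ((Algebra.IsSeparable.isSeparable K₁ pb.gen).aeval_derivative_ne_zero (minpoly.aeval _ _))
  · let g₁ : K₁ →+* K := IsFractionRing.lift hg
    have hg₁ : g₁.comp (algebraMap R K₁) = g :=
      RingHom.ext fun r => IsFractionRing.lift_algebraMap hg r
    let := g₁.toAlgebra
    have hy : aeval y' (minpoly K₁ pb.gen) = 0 := by
      rw [← hg₁, ← eval₂_map, hf', eval₂_mul, eval₂_C] at hy'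
      exact (mul_eq_zero.1 hy').resolve_left ((_root_.map_ne_zero _).2 hb')
    refine ⟨(pb.lift y' hy : E →+* K), ?_⟩
    rw [← RingHom.comp_assoc, AlgHom.comp_algebraMap]
    exact hg₁

open Polynomial in
/-- If `E` is separable over `F(s)` for a transcendence basis `s` of the finitely generated
extension `E / F`, homomorphisms over `F` from `E` to a field `K` are obtained from algebraically
independent families in `K` and roots in `K` of a polynomial over `F[s]` with a simple root
in `E`. -/
theorem IsTranscendenceBasis.exists_simple_root_forall_exists_ringHom {F E ι : Type*} [Field F]
    [Field E] [Algebra F E] [Algebra.EssFiniteType F E] {s : ι → E} (hs : IsTranscendenceBasis F s)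
    [Algebra.IsSeparable (IntermediateField.adjoin F (Set.range s)) E] :
    ∃ (y : E) (f : (MvPolynomial ι F)[X]),
      f.eval₂ (MvPolynomial.eval₂Hom (algebraMap F E) s) y = 0 ∧
      f.derivative.eval₂ (MvPolynomial.eval₂Hom (algebraMap F E) s) y ≠ 0 ∧
      ∀ {K : Type w} [Field K] (e : F →+* K) (s' : ι → K) (y' : K),
        Function.Injective (MvPolynomial.eval₂Hom e s') →
        f.eval₂ (MvPolynomial.eval₂Hom e s') y' = 0 →
        ∃ φ : E →+* K, φ.comp (algebraMap F E) = e := by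
  set K₁ := IntermediateField.adjoin F (Set.range s)
  have : Algebra.EssFiniteType K₁ E := Algebra.EssFiniteType.of_comp F K₁ E
  have := Algebra.FormallyUnramified.of_isSeparable K₁ E
  have := Algebra.FormallyUnramified.finite_of_free (R := K₁) (S := E)
  let ε : FractionRing (MvPolynomial ι F) ≃ₐ[F] K₁ := hs.1.aevalEquivField
  let : Algebra (MvPolynomial ι F) K₁ :=
    ((ε : _ →+* K₁).comp (algebraMap (MvPolynomial ι F) (FractionRing (MvPolynomial ι F)))).toAlgebra
  have : IsFractionRing (MvPolynomial ι F) K₁ :=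
    IsLocalization.isLocalization_of_algEquiv _ (AlgEquiv.ofRingEquiv (f := ε.toRingEquiv)
      fun _ => rfl)
  have hε : (algebraMap K₁ E).comp (algebraMap (MvPolynomial ι F) K₁) =
      MvPolynomial.eval₂Hom (algebraMap F E) s :=
    RingHom.ext fun p => hs.1.aevalEquivField_algebraMap_apply_coe p
  obtain ⟨y, f, hy, hy', h⟩ :=
    IsFractionRing.exists_simple_root_forall_exists_ringHom.{w} (R := MvPolynomial ι F) (K₁ := K₁)
      (E := E)
  rw [hε] at hy hy'
  refine ⟨y, f, hy, hy', fun e s' z hinj hz => ?_⟩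
  obtain ⟨φ, hφ⟩ := h _ z hinj hz
  refine ⟨φ, RingHom.ext fun a => ?_⟩
  simpa [hε] using RingHom.congr_fun hφ (MvPolynomial.C a)

open Filter in
/-- A field `F` with an embedding into `K` such that `K` is henselian and dense in a fraction field
`L` of `F⟦X⟧`: systems of polynomial equations and inequations over `F` that are solvable in `L` are
solvable in `K`. -/
theorem PowerSeries.exists_solution_of_denseRange {F : Type u} {K : Type v} {L : Type w} [Field F]
    [Field K] [Field L] [Algebra F L] [Algebra (PowerSeries F) L] [IsScalarTower F (PowerSeries F) L]
    [IsFractionRing (PowerSeries F) L] [TopologicalSpace L] [IsTopologicalRing L]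
    [ContinuousInv₀ L] [T1Space L] {A : ValuationSubring L}
    (hAo : IsOpen (A : Set L)) (hAn : IsOpen (A.nonunits : Set L)) {e : F →+* K} {j : K →+* L}
    (hje : j.comp e = algebraMap F L) (hj : DenseRange j) [HenselianLocalRing (A.comap j)] {n : ℕ}
    {S T : Finset (MvPolynomial (Fin n) F)} {x : Fin n → L}
    (hS : ∀ q ∈ S, MvPolynomial.eval₂ (algebraMap F L) x q = 0)
    (hT : ∀ q ∈ T, MvPolynomial.eval₂ (algebraMap F L) x q ≠ 0) :
    ∃ x : Fin n → K, (∀ q ∈ S, MvPolynomial.eval₂ e x q = 0) ∧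
      ∀ q ∈ T, MvPolynomial.eval₂ e x q ≠ 0 := by
  let E := IntermediateField.adjoin F (Set.range x)
  have : Algebra.EssFiniteType F E := IntermediateField.essFiniteType_iff.2
    (IntermediateField.fg_adjoin_of_finite (Set.finite_range x))
  obtain ⟨s, hs, hsep⟩ := PowerSeries.exists_isTranscendenceBasis_and_isSeparable E
  have : Algebra.IsSeparable (IntermediateField.adjoin F (Set.range ((↑) : s → E))) E := by
    convert hsep <;> exact Subtype.range_coe
  obtain ⟨y, f, hy, hy', h⟩ := hs.exists_simple_root_forall_exists_ringHom.{max v w}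
  have hE : (algebraMap E L).comp (MvPolynomial.eval₂Hom (algebraMap F E) ((↑) : s → E)) =
      MvPolynomial.eval₂Hom (j.comp e) fun i : s => algebraMap E L i := by
    rw [MvPolynomial.comp_eval₂Hom, hje]
    rfl
  obtain ⟨U, s', y', hs', hy''⟩ := exists_germ_root_of_denseRange hAo hAn e hj
    (s := fun i : s => algebraMap E L i) (y := algebraMap E L y) (f := f)
    (by
      rw [← hE]
      exact (algebraMap E L).injective.comp hs.1)
    (by rw [← hE, ← Polynomial.hom_eval₂, hy, map_zero])
    (by
      rw [← hE, ← Polynomial.hom_eval₂]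
      exact (_root_.map_ne_zero _).2 hy')
  obtain ⟨φ, hφ⟩ := h _ s' y' hs' hy''
  let x' : Fin n → E := fun i => ⟨x i, IntermediateField.subset_adjoin _ _ ⟨i, rfl⟩⟩
  have hx' (q : MvPolynomial (Fin n) F) :
      algebraMap E L (MvPolynomial.eval₂ (algebraMap F E) x' q) =
        MvPolynomial.eval₂ (algebraMap F L) x q :=
    MvPolynomial.hom_eval₂ q _ _ _
  choose z hz using fun i => Quotient.exists_rep (φ (x' i))
  have hzq (q : MvPolynomial (Fin n) F) : φ (MvPolynomial.eval₂ (algebraMap F E) x' q) =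
      ((fun a => MvPolynomial.eval₂ e (fun i => z i a) q : (s → K) × K × K → K) :
        Germ (U : Filter ((s → K) × K × K)) K) := by
    rw [MvPolynomial.hom_eval₂, hφ, ← funext hz]
    exact RingHom.congr_fun
      (MvPolynomial.eval₂Hom_germ (U : Filter ((s → K) × K × K)) e fun a i => z i a) q
  have h0 (q : MvPolynomial (Fin n) F) : MvPolynomial.eval₂ (algebraMap F L) x q = 0 ↔
      ∀ᶠ a in (U : Filter ((s → K) × K × K)), MvPolynomial.eval₂ e (fun i => z i a) q = 0 := by
    rw [← hx', _root_.map_eq_zero, ← _root_.map_eq_zero φ, hzq]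
    exact Germ.coe_eq
  have hS' : ∀ᶠ a in (U : Filter ((s → K) × K × K)),
      ∀ q ∈ S, MvPolynomial.eval₂ e (fun i => z i a) q = 0 :=
    (Finset.eventually_all _).2 fun q hq => (h0 q).1 (hS q hq)
  have hT' : ∀ᶠ a in (U : Filter ((s → K) × K × K)),
      ∀ q ∈ T, MvPolynomial.eval₂ e (fun i => z i a) q ≠ 0 :=
    (Finset.eventually_all _).2 fun q hq =>
      Ultrafilter.eventually_not.2 fun hq' => hT q hq ((h0 q).2 hq')
  obtain ⟨a, haS, haT⟩ := (hS'.and hT').exists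
  exact ⟨_, haS, haT⟩

theorem LaurentSeries.denseRange_subtype {F : Type*} [Field F] {M : Subfield (LaurentSeries F)}
    (hC : ∀ c : F, algebraMap F (LaurentSeries F) c ∈ M)
    (hX : HahnSeries.single (1 : ℤ) (1 : F) ∈ M) : DenseRange M.subtype := by
  have hpoly (p : Polynomial F) : ((p : PowerSeries F) : LaurentSeries F) ∈ M := by
    induction p using Polynomial.induction_on' with
    | add p q hp hq => simpa using add_mem hp hq
    | monomial n a =>
      have := mul_mem (hC a) (pow_mem hX n)
      rw [← Polynomial.C_mul_X_pow_eq_monomial]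
      simpa [LaurentSeries.algebraMap_apply] using this
  have hrat (r : RatFunc F) : (r : LaurentSeries F) ∈ M := by
    induction r using RatFunc.induction_on with
    | _ p q hq =>
      rw [RatFunc.algebraMap_apply_div]
      exact div_mem (hpoly p) (hpoly q)
  refine (LaurentSeries.coe_range_dense (K := F)).mono ?_
  rintro _ ⟨r, rfl⟩
  exact ⟨⟨_, hrat r⟩, rfl⟩

theorem Valued.isOpen_nonunits_valuationSubring {K Γ₀ : Type*} [Field K]
    [LinearOrderedCommGroupWithZero Γ₀] [Valued K Γ₀] :
    IsOpen ((Valued.v.valuationSubring : ValuationSubring K).nonunits : Set K) := by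
  have h : ((Valued.v.valuationSubring : ValuationSubring K).nonunits : Set K) =
      {x : K | Valued.v.restrict x < 1} := by
    ext x
    rw [SetLike.mem_coe, ValuationSubring.mem_nonunits_iff_or, Set.mem_ofPred_eq,
      Valuation.restrict_lt_one_iff, Valuation.mem_valuationSubring_iff, map_inv₀]
    rcases eq_or_ne x 0 with rfl | hx
    · simp
    · simp [hx, one_lt_inv₀ (zero_lt_iff.2 ((Valuation.ne_zero_iff Valued.v).2 hx))]
  rw [h]
  exact Valued.isOpen_ball _ _

/-- Systems of polynomial equations and inequations over `F` that are solvable in `F((t))` are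
solvable in `F(t)ʰ`. -/
theorem exists_solution_tAdicHenselization {F : Type*} [Field F] {n : ℕ}
    {S T : Finset (MvPolynomial (Fin n) F)} {x : Fin n → LaurentSeries F}
    (hS : ∀ q ∈ S, MvPolynomial.eval₂ (algebraMap F (LaurentSeries F)) x q = 0)
    (hT : ∀ q ∈ T, MvPolynomial.eval₂ (algebraMap F (LaurentSeries F)) x q ≠ 0) :
    ∃ x : Fin n → tAdicHenselization F,
      (∀ q ∈ S, MvPolynomial.eval₂ (toTAdicHenselization F) x q = 0) ∧
      ∀ q ∈ T, MvPolynomial.eval₂ (toTAdicHenselization F) x q ≠ 0 := by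
  rcases Set.eq_empty_or_nonempty {M : Subfield (LaurentSeries F) |
    (∀ c : F, algebraMap F (LaurentSeries F) c ∈ M) ∧
    HahnSeries.single (1 : ℤ) (1 : F) ∈ M ∧
    HenselianLocalRing
      ↥((Valued.v.valuationSubring : ValuationSubring (LaurentSeries F)).comap M.subtype)}
    with h | h
  · have htop (y : LaurentSeries F) : y ∈ tAdicHenselization F := by
      rw [tAdicHenselization, h, sInf_empty]
      trivial
    let z : Fin n → tAdicHenselization F := fun i => ⟨x i, htop _⟩
    have hz (q : MvPolynomial (Fin n) F) :
        (tAdicHenselization F).subtype (MvPolynomial.eval₂ (toTAdicHenselization F) z q) =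
          MvPolynomial.eval₂ (algebraMap F (LaurentSeries F)) x q :=
      MvPolynomial.hom_eval₂ q _ _ _
    refine ⟨z, fun q hq => ?_, fun q hq h0 => hT q hq ?_⟩
    · rw [← map_eq_zero (tAdicHenselization F).subtype, hz, hS q hq]
    · rw [← hz, h0, map_zero]
  · have := IsScalarTower.of_algebraMap_eq (R := F) (S := PowerSeries F) (A := LaurentSeries F)
      fun _ => rfl
    have : HenselianLocalRing ((Valued.v.valuationSubring :
        ValuationSubring (LaurentSeries F)).comap (tAdicHenselization F).subtype) :=
      ValuationSubring.henselianLocalRing_comap_sInf _ h fun M hM => hM.2.2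
    exact PowerSeries.exists_solution_of_denseRange (Valued.isOpen_valuationSubring _)
      Valued.isOpen_nonunits_valuationSubring (e := toTAdicHenselization F)
      (j := (tAdicHenselization F).subtype) rfl
      (LaurentSeries.denseRange_subtype (fun c => Subfield.mem_sInf.2 fun M hM => hM.1 c)
        (Subfield.mem_sInf.2 fun M hM => hM.2.1)) hS hT

/-- A field `F` is existentially closed in `F((t))` iff it is existentially closed in the
henselization `F(t)ʰ` of `F(t)` with respect to the `t`-adic valuation. -/
theorem stmt_14 (F : Type*) [Field F] :
    ExistClosedAlong (algebraMap F (LaurentSeries F)) ↔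
      ExistClosedAlong (toTAdicHenselization F) := by
  refine ⟨fun h n S T ⟨x, hS, hT⟩ => h n S T ⟨fun i => x i, fun q hq => ?_, fun q hq h0 => ?_⟩,
    fun h n S T ⟨x, hS, hT⟩ => h n S T (exists_solution_tAdicHenselization hS hT)⟩
  · exact (MvPolynomial.hom_eval₂ q (toTAdicHenselization F)
      (tAdicHenselization F).subtype x).symm.trans ((congrArg _ (hS q hq)).trans (map_zero _))
  · refine hT q hq ((map_eq_zero (tAdicHenselization F).subtype).1 ?_)
    exact (MvPolynomial.hom_eval₂ q _ _ _).trans h0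
end

section
/- Let $F/E$ be a separable field extension with $E$ pseudo-algebraically closed (PAC), and let $\tilde{E}$ be the relative algebraic closure of $E$ in $F$. Then $\tilde{E}$ is existentially closed in $F$. -/
/-- A field is pseudo-algebraically closed: every geometrically integral affine variety over it
(cut out by an ideal which stays prime over the algebraic closure) has a rational point. -/
def IsPAC (E : Type*) [Field E] : Prop :=
  ∀ (n : ℕ) (I : Ideal (MvPolynomial (Fin n) E)),
    (Ideal.map (MvPolynomial.map (algebraMap E (AlgebraicClosure E))) I).IsPrime →
    ∃ x : Fin n → E, ∀ p ∈ I, MvPolynomial.eval x p = 0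

open scoped TensorProduct

theorem exists_algHom_apply_ne_zero {k A : Type*} [Field k] [IsAlgClosed k] [CommRing A] [IsDomain A]
    [Algebra k A] [Algebra.FiniteType k A] {a : A} (ha : a ≠ 0) : ∃ φ : A →ₐ[k] k, φ a ≠ 0 := by
  let B := Localization.Away a
  have : Nontrivial B :=
    (IsLocalization.injective B (powers_le_nonZeroDivisors_of_noZeroDivisors ha)).nontrivial
  obtain ⟨m, hm⟩ := Ideal.exists_maximal B
  let : Field (B ⧸ m) := Ideal.Quotient.field m
  have : Module.Finite k (B ⧸ m) := finite_of_finite_type_of_isJacobsonRing _ _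
  let e : k ≃ₐ[k] (B ⧸ m) := AlgEquiv.ofBijective (Algebra.ofId k _)
    IsAlgClosed.algebraMap_bijective_of_isIntegral
  refine ⟨(e.symm.toAlgHom.comp (Ideal.Quotient.mkₐ k m)).comp (IsScalarTower.toAlgHom k A B), ?_⟩
  exact ((IsLocalization.map_units B (⟨a, Submonoid.mem_powers a⟩ : Submonoid.powers a)).map
    (e.symm.toAlgHom.comp (Ideal.Quotient.mkₐ k m))).ne_zero

theorem isDomain_tensorProduct_of_isAlgClosed {k A B : Type*} [Field k] [IsAlgClosed k] [CommRing A]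
    [IsDomain A] [CommRing B] [IsDomain B] [Algebra k A] [Algebra k B] [Algebra.FiniteType k A] :
    IsDomain (A ⊗[k] B) := by
  let b := Module.Free.chooseBasis k B
  let β := Algebra.TensorProduct.basis A b
  have key (φ : A →ₐ[k] k) (z : A ⊗[k] B) :
      Algebra.TensorProduct.lift ((Algebra.ofId k B).comp φ) (AlgHom.id k B)
        (fun _ _ ↦ Commute.all _ _) z = Finsupp.linearCombination k b
          ((β.repr z).mapRange φ (map_zero φ)) := by
    conv_lhs => rw [← β.linearCombination_repr z]
    rw [Finsupp.linearCombination_apply, Finsupp.linearCombination_apply, Finsupp.sum_mapRange_index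
      (by simp), map_finsuppSum]
    refine Finsupp.sum_congr fun i _ ↦ ?_
    simp [β, Algebra.ofId_apply, Algebra.smul_def]
  have : NoZeroDivisors (A ⊗[k] B) := by
    refine ⟨fun {x y} hxy ↦ ?_⟩
    by_contra! h
    obtain ⟨i, hi⟩ := Finsupp.ne_iff.mp (β.repr.map_ne_zero_iff.mpr h.1)
    obtain ⟨j, hj⟩ := Finsupp.ne_iff.mp (β.repr.map_ne_zero_iff.mpr h.2)
    obtain ⟨φ, hφ⟩ := exists_algHom_apply_ne_zero (k := k) (mul_ne_zero hi hj)
    have := congrArg (Algebra.TensorProduct.lift ((Algebra.ofId k B).comp φ) (AlgHom.id k B)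
        (fun _ _ ↦ Commute.all _ _)) hxy
    rw [map_mul, map_zero, key, key, mul_eq_zero] at this
    rw [map_mul, mul_ne_zero_iff] at hφ
    rcases this with h | h
    · have := linearIndependent_iff.mp b.linearIndependent _ h
      exact hφ.1 (by simpa using DFunLike.congr_fun this i)
    · have := linearIndependent_iff.mp b.linearIndependent _ h
      exact hφ.2 (by simpa using DFunLike.congr_fun this j)
  have : Nontrivial (A ⊗[k] B) := inferInstance
  exact NoZeroDivisors.to_isDomain _

theorem map_map_eq_map {R S T F G H : Type*} [CommRing R] [CommRing S] [CommRing T] [FunLike F R S]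
    [RingHomClass F R S] [FunLike G S T] [RingHomClass G S T] [FunLike H R T] [RingHomClass H R T]
    {f : F} {g : G} {h : H} {I : Ideal R} (hfg : ∀ x, g (f x) = h x) :
    (I.map f).map g = I.map h := by
  refine le_antisymm ?_ ?_
  · rw [Ideal.map_le_iff_le_comap, Ideal.map_le_iff_le_comap]
    intro x hx
    simpa [hfg] using Ideal.mem_map_of_mem h hx
  · rw [Ideal.map_le_iff_le_comap]
    intro x hx
    rw [Ideal.mem_comap, ← hfg]
    exact Ideal.mem_map_of_mem g (Ideal.mem_map_of_mem f hx)

open MvPolynomial in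
theorem isPrime_map_rename_sup {k : Type*} [Field k] [IsAlgClosed k] {σ τ : Type*} [Finite σ]
    (P : Ideal (MvPolynomial σ k)) (Q : Ideal (MvPolynomial τ k)) [P.IsPrime] [Q.IsPrime] :
    (P.map (rename (R := k) (Sum.inl : σ → σ ⊕ τ)) ⊔
      Q.map (rename (R := k) (Sum.inr : τ → σ ⊕ τ))).IsPrime := by
  have := isDomain_tensorProduct_of_isAlgClosed (k := k) (A := MvPolynomial σ k ⧸ P)
    (B := MvPolynomial τ k ⧸ Q)
  let e := tensorEquivSum k σ τ k
  have h := Algebra.TensorProduct.map_ker (f := Ideal.Quotient.mkₐ k P) (g := Ideal.Quotient.mkₐ k Q)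
    (Ideal.Quotient.mkₐ_surjective _ _) (Ideal.Quotient.mkₐ_surjective _ _)
  have hp := RingHom.ker_isPrime (Algebra.TensorProduct.map (Ideal.Quotient.mkₐ k P)
    (Ideal.Quotient.mkₐ k Q)).toRingHom
  have hp' := Ideal.map_isPrime_of_equiv (I := RingHom.ker (Algebra.TensorProduct.map (Ideal.Quotient.mkₐ k P)
    (Ideal.Quotient.mkₐ k Q)).toRingHom) e
  have e1 : e.toAlgHom.comp Algebra.TensorProduct.includeLeft =
      rename (R := k) (Sum.inl : σ → σ ⊕ τ) := by ext; simp [e]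
  have e2 : e.toAlgHom.comp Algebra.TensorProduct.includeRight =
      rename (R := k) (Sum.inr : τ → σ ⊕ τ) := by ext; simp [e]
  convert hp'
  refine Eq.trans ?_ (congrArg (Ideal.map e) h.symm)
  rw [show RingHom.ker (Ideal.Quotient.mkₐ k P) = P from Ideal.Quotient.mkₐ_ker k P,
    show RingHom.ker (Ideal.Quotient.mkₐ k Q) = Q from Ideal.Quotient.mkₐ_ker k Q,
    Ideal.map_sup, map_map_eq_map fun x ↦ DFunLike.congr_fun e1 x,
    map_map_eq_map fun x ↦ DFunLike.congr_fun e2 x]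

open MvPolynomial in
theorem isPrime_iSup_map_rename {k : Type*} [Field k] [IsAlgClosed k] {τ : Type*} [Finite τ]
    (ι : Type*) [Finite ι] :
    ∀ (P : ι → Ideal (MvPolynomial τ k)), (∀ i, (P i).IsPrime) →
      (⨆ i, (P i).map (rename (R := k) (fun t : τ ↦ (i, t)))).IsPrime := by
  induction ι using Finite.induction_empty_option with
  | of_equiv e ih =>
    intro P hP
    have := ih (P ∘ e) fun i ↦ hP _
    convert Ideal.map_isPrime_of_equiv (renameEquiv k (e.prodCongr (Equiv.refl τ)))
      (I := ⨆ i, ((P ∘ e) i).map (rename (R := k) (fun t : τ ↦ (i, t))))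
    rw [Ideal.map_iSup, ← e.iSup_comp]
    refine iSup_congr fun i ↦ ?_
    rw [map_map_eq_map (h := rename (R := k) (fun t : τ ↦ (e i, t)))
      fun x ↦ by simp [rename_rename]; rfl]
    rfl
  | h_empty =>
    intro P hP
    rw [iSup_of_empty]
    exact Ideal.isPrime_bot
  | @h_option α _ ih =>
    intro P hP
    have h1 := ih (fun a ↦ P (some a)) fun i ↦ hP _
    have h2 := hP none
    have h3 := isPrime_map_rename_sup (P none)
      (⨆ i, (P (some i)).map (rename (R := k) (fun t : τ ↦ (i, t))))
    let e : τ ⊕ (α × τ) ≃ Option α × τ := (Equiv.sumCongr (Equiv.punitProd.{0} τ).symm (Equiv.refl _)).trans <|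
      (Equiv.sumComm _ _).trans <| (Equiv.sumProdDistrib _ _ _).symm.trans <|
      Equiv.prodCongr (Equiv.optionEquivSumPUnit α).symm (Equiv.refl _)
    convert @Ideal.map_isPrime_of_equiv _ _ _ _ _ _ _ (renameEquiv k e) _ h3
    rw [iSup_option, Ideal.map_sup, Ideal.map_iSup, Ideal.map_iSup]
    congr 1
    · rw [map_map_eq_map (h := rename (R := k) (fun t : τ ↦ (none, t)))
        fun x ↦ by simp [rename_rename]; rfl]
    · refine iSup_congr fun i ↦ ?_
      rw [map_map_eq_map (h := rename (R := k) (fun t : τ ↦ (Sum.inr (i, t)))) fun x ↦ by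
          simp [rename_rename]; rfl, map_map_eq_map (h := rename (R := k) (fun t : τ ↦ (some i, t)))
          fun x ↦ by simp [rename_rename]; rfl]

open MvPolynomial in
theorem IsPAC.exists_eval_eq_zero {E τ : Type*} [Field E] [Finite τ] (hE : IsPAC E)
    (I : Ideal (MvPolynomial τ E))
    (hI : (I.map (map (σ := τ) (algebraMap E (AlgebraicClosure E)))).IsPrime) :
    ∃ x : τ → E, ∀ p ∈ I, eval x p = 0 := by
  obtain ⟨m, ⟨e⟩⟩ := Finite.exists_equiv_fin τ
  have h : ((I.map (renameEquiv E e)).map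
      (map (σ := Fin m) (algebraMap E (AlgebraicClosure E)))).IsPrime := by
    convert @Ideal.map_isPrime_of_equiv _ _ _ _ _ _ _ (renameEquiv (AlgebraicClosure E) e) _ hI
    rw [map_map_eq_map (h := (rename (R := AlgebraicClosure E) e).toRingHom.comp
      (map (algebraMap E (AlgebraicClosure E)))) fun x ↦ by simp [map_rename],
      map_map_eq_map (h := (rename (R := AlgebraicClosure E) e).toRingHom.comp
      (map (algebraMap E (AlgebraicClosure E)))) fun x ↦ by simp]
  obtain ⟨x, hx⟩ := hE m _ h
  refine ⟨x ∘ e, fun p hp ↦ ?_⟩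
  simpa [eval_rename] using hx _ (Ideal.mem_map_of_mem (renameEquiv E e) hp)

namespace MvPolynomial

theorem exists_eq_sum_C_basis_mul_map {E L κ τ : Type*} [Field E] [Field L] [Algebra E L]
    [Fintype κ] (b : Module.Basis κ E L) (q : MvPolynomial τ L) :
    ∃ c : κ → MvPolynomial τ E, q = ∑ j, C (b j) * map (algebraMap E L) (c j) := by
  induction q using MvPolynomial.induction_on' with
  | monomial m a =>
    refine ⟨fun j ↦ monomial m (b.repr a j), ?_⟩
    conv_lhs => rw [← b.sum_repr a]
    simp only [map_sum, map_monomial, C_mul_monomial, Algebra.smul_def]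
    exact Finset.sum_congr rfl fun j _ ↦ by rw [mul_comm]
  | add p q hp hq =>
    obtain ⟨c, hc⟩ := hp
    obtain ⟨d, hd⟩ := hq
    refine ⟨c + d, ?_⟩
    rw [hc, hd, ← Finset.sum_add_distrib]
    simp [mul_add]

/-- The linear substitution `X (i, t) ↦ ∑ j, M i j * X (j, t)`. -/
noncomputable def matrixSubst {k κ : Type*} (τ : Type*) [Field k] [Fintype κ] (M : Matrix κ κ k) :
    MvPolynomial (κ × τ) k →ₐ[k] MvPolynomial (κ × τ) k :=
  aeval fun it ↦ ∑ j, C (M it.1 j) * X (j, it.2)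

theorem matrixSubst_comp_of_mul_eq_one {k κ : Type*} (τ : Type*) [Field k] [Fintype κ]
    [DecidableEq κ] {M N : Matrix κ κ k} (h : M * N = 1) :
    (matrixSubst τ N).comp (matrixSubst τ M) = AlgHom.id k _ := by
  ext1 ⟨i, t⟩
  simp only [matrixSubst, AlgHom.comp_apply, aeval_X, map_sum, map_mul, algHom_C, algebraMap_eq,
    Finset.mul_sum, AlgHom.id_apply]
  rw [Finset.sum_comm]
  simp_rw [← mul_assoc, ← C_mul, ← Finset.sum_mul, ← map_sum, ← Matrix.mul_apply, h]
  simp [Matrix.one_apply]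

/-- The linear change of variables given by a pair of mutually inverse matrices. -/
noncomputable def matrixSubstEquiv {k κ : Type*} (τ : Type*) [Field k] [Fintype κ]
    [DecidableEq κ] {M N : Matrix κ κ k} (h : M * N = 1) (h' : N * M = 1) :
    MvPolynomial (κ × τ) k ≃ₐ[k] MvPolynomial (κ × τ) k :=
  AlgEquiv.ofAlgHom (matrixSubst τ M) (matrixSubst τ N)
    (matrixSubst_comp_of_mul_eq_one τ h') (matrixSubst_comp_of_mul_eq_one τ h)

end MvPolynomial

open MvPolynomial in
/-- The existence of points over finite separable extensions of PAC fields, via Weil restriction. -/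
theorem IsPAC.exists_eval_eq_zero_of_isSeparable {E L τ : Type*} [Field E] [Field L] [Algebra E L]
    [FiniteDimensional E L] [Algebra.IsSeparable E L] [Finite τ] (hE : IsPAC E)
    (s : Set (MvPolynomial τ L))
    (hs : ∀ σ : L →ₐ[E] AlgebraicClosure E,
      (Ideal.span (map (σ : L →+* AlgebraicClosure E) '' s)).IsPrime) :
    ∃ x : τ → L, ∀ p ∈ s, eval x p = 0 := by
  classical
  set K := AlgebraicClosure E
  let b := Module.finBasis E L
  let e : Fin (Module.finrank E L) ≃ (L →ₐ[E] K) :=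
    Fintype.equivOfCardEq (by rw [AlgHom.card, Fintype.card_fin])
  let M : Matrix (Fin (Module.finrank E L)) (Fin (Module.finrank E L)) K := fun i j ↦ e i (b j)
  have hM : IsUnit M.det := by
    have h := Algebra.discr_eq_det_embeddingsMatrixReindex_pow_two E K b e
    have h' : Algebra.embeddingsMatrixReindex E K b e = M.transpose := rfl
    rw [h', Matrix.det_transpose] at h
    refine isUnit_iff_ne_zero.mpr fun h0 ↦ Algebra.discr_not_zero_of_basis E b ?_
    apply (algebraMap E K).injective
    rw [h, h0, map_zero, zero_pow two_ne_zero]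
  let φ := matrixSubstEquiv τ (Matrix.mul_nonsing_inv M hM) (Matrix.nonsing_inv_mul M hM)
  let θ : MvPolynomial τ L →ₐ[L] MvPolynomial (Fin (Module.finrank E L) × τ) L :=
    aeval fun t ↦ ∑ j, C (b j) * X (j, t)
  choose c hc using exists_eq_sum_C_basis_mul_map (τ := Fin (Module.finrank E L) × τ) b
  have hθ (i) (p : MvPolynomial τ L) : map (e i : L →+* K) (θ p) =
      φ (rename (fun t ↦ (i, t)) (map (e i : L →+* K) p)) := by
    induction p using MvPolynomial.induction_on with
    | C a => simp [φ, matrixSubstEquiv]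
    | add p q hp hq => simp only [map_add, hp, hq]
    | mul_X p t hp =>
      simp only [map_mul, hp]
      simp [θ, φ, matrixSubstEquiv, matrixSubst, M]
  have hθc (i) (p : MvPolynomial τ L) : map (e i : L →+* K) (θ p) =
      ∑ j, C (M i j) * map (algebraMap E K) (c (θ p) j) := by
    conv_lhs => rw [hc (θ p)]
    simp [M, map_map]
  have hcθ (j) (p : MvPolynomial τ L) : map (algebraMap E K) (c (θ p) j) =
      ∑ i, C (M⁻¹ j i) * map (e i : L →+* K) (θ p) := by
    simp_rw [hθc, Finset.mul_sum]
    rw [Finset.sum_comm]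
    simp_rw [← mul_assoc, ← C_mul, ← Finset.sum_mul, ← map_sum, ← Matrix.mul_apply,
      Matrix.nonsing_inv_mul M hM]
    simp [Matrix.one_apply]
  obtain ⟨y, hy⟩ := hE.exists_eval_eq_zero (Ideal.span {q | ∃ p ∈ s, ∃ j, q = c (θ p) j}) (by
    convert @Ideal.map_isPrime_of_equiv _ _ _ _ _ _ _ φ _
      (isPrime_iSup_map_rename _ _ fun i ↦ hs (e i))
    rw [Ideal.map_iSup, Ideal.map_span]
    apply le_antisymm
    · rw [Ideal.span_le]
      rintro _ ⟨_, ⟨p, hp, j, rfl⟩, rfl⟩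
      rw [SetLike.mem_coe, hcθ]
      refine Ideal.sum_mem _ fun i _ ↦ Ideal.mul_mem_left _ _ ?_
      refine Ideal.mem_iSup_of_mem i ?_
      rw [hθ]
      exact Ideal.mem_map_of_mem _ (Ideal.mem_map_of_mem _ (Ideal.subset_span ⟨p, hp, rfl⟩))
    · refine iSup_le fun i ↦ ?_
      rw [Ideal.map_span, Ideal.map_span, Ideal.span_le]
      rintro _ ⟨_, ⟨_, ⟨p, hp, rfl⟩, rfl⟩, rfl⟩
      rw [SetLike.mem_coe, ← hθ, hθc]
      refine Ideal.sum_mem _ fun j _ ↦ Ideal.mul_mem_left _ _ ?_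
      exact Ideal.subset_span ⟨_, ⟨p, hp, j, rfl⟩, rfl⟩)
  refine ⟨fun t ↦ ∑ j, b j * algebraMap E L (y (j, t)), fun p hp ↦ ?_⟩
  have h1 (p : MvPolynomial τ L) : eval (fun t ↦ ∑ j, b j * algebraMap E L (y (j, t))) p =
      eval (fun i ↦ algebraMap E L (y i)) (θ p) := by
    induction p using MvPolynomial.induction_on with
    | C a => simp
    | add p q hp hq => simp only [map_add, hp, hq]
    | mul_X p t hp =>
      simp only [map_mul, hp]
      simp [θ]
  rw [h1, hc (θ p), map_sum]
  refine Finset.sum_eq_zero fun j _ ↦ ?_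
  rw [map_mul, eval_map, ← Function.comp_def, ← eval₂_comp, hy _ (Ideal.subset_span ⟨p, hp, j, rfl⟩),
    map_zero, mul_zero]

open Polynomial in
theorem aeval_eq_zero_of_aeval_pow_eq_zero {R S : Type*} [CommRing R] [CommRing S] [Algebra R S]
    [IsReduced S] (x : S) {p : R[X]} {n : ℕ} (h : aeval x (p ^ n) = 0) : aeval x p = 0 :=
  IsReduced.eq_zero _ ⟨n, by rw [← map_pow, h]⟩

open Polynomial in
theorem aeval_one_tmul_map {E K L : Type*} [Field E] [Field K] [CommRing L] [Algebra E K]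
    [Algebra E L] (x : L) (p : E[X]) :
    aeval ((1 : K) ⊗ₜ[E] x) (p.map (algebraMap E K)) = 1 ⊗ₜ aeval x p := by
  have h : (1 : K) ⊗ₜ[E] x = (Algebra.TensorProduct.includeRight : L →ₐ[E] K ⊗[E] L) x := rfl
  rw [aeval_map_algebraMap, h, aeval_algHom_apply]
  rfl

open Polynomial in
theorem PowerBasis.isSeparable_gen_of_isReduced_tensorProduct {E L : Type*} (K : Type*) [Field E]
    [Field L] [Field K] [IsAlgClosed K] [Algebra E L] [Algebra E K] [IsReduced (K ⊗[E] L)]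
    (pb : PowerBasis E L) : IsSeparable E pb.gen := by
  have hdeg (p : K[X]) (hp : p.degree < pb.dim) (h0 : aeval ((1 : K) ⊗ₜ[E] pb.gen) p = 0) :
      p = 0 := by
    have hli := (pb.basis.baseChange K).linearIndependent
    rw [Fintype.linearIndependent_iff] at hli
    have h1 := hli (fun i ↦ p.coeff i) (by
      simp only [Module.Basis.baseChange_apply, PowerBasis.coe_basis]
      rcases eq_or_ne p 0 with rfl | hp0
      · simp
      rw [aeval_eq_sum_range' ((natDegree_lt_iff_degree_lt hp0).mpr hp), ← Fin.sum_univ_eq_sum_range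
        (fun i ↦ p.coeff i • ((1 : K) ⊗ₜ[E] pb.gen) ^ i)] at h0
      simpa using h0)
    ext i
    by_cases hi : i < pb.dim
    · exact h1 ⟨i, hi⟩
    · exact coeff_eq_zero_of_degree_lt (hp.trans_le (by exact_mod_cast not_lt.mp hi))
  have hm0 : (minpoly E pb.gen).map (algebraMap E K) ≠ 0 :=
    map_ne_zero (minpoly.ne_zero pb.isIntegral_gen)
  have hroot : aeval ((1 : K) ⊗ₜ[E] pb.gen) ((minpoly E pb.gen).map (algebraMap E K)) = 0 := by
    rw [aeval_one_tmul_map, minpoly.aeval, TensorProduct.tmul_zero]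
  rw [IsSeparable, ← separable_map (algebraMap E K), PerfectField.separable_iff_squarefree]
  rintro q ⟨g, hg⟩
  by_contra hq
  have hqg : q * g = 0 := by
    refine hdeg _ ?_ ?_
    · have hq0 : q ≠ 0 := by rintro rfl; simp [hg] at hm0
      have hg0 : g ≠ 0 := by rintro rfl; simp [hg] at hm0
      have hqd := natDegree_pos_iff_degree_pos.mpr (degree_pos_of_ne_zero_of_nonunit hq0 hq)
      have hd := congrArg natDegree hg
      rw [natDegree_map, pb.natDegree_minpoly, mul_assoc, natDegree_mul hq0 (mul_ne_zero hq0 hg0)]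
        at hd
      rw [degree_eq_natDegree (mul_ne_zero hq0 hg0), hd]
      exact_mod_cast Nat.lt_add_of_pos_left hqd
    · have hqg2 : (q * g) ^ 2 = g * (minpoly E pb.gen).map (algebraMap E K) := by rw [hg]; ring
      exact aeval_eq_zero_of_aeval_pow_eq_zero _ (n := 2) (by rw [hqg2, map_mul, hroot, mul_zero])
  apply hm0
  rw [hg, mul_assoc, hqg, mul_zero]

open IntermediateField in
/-- An algebraic extension with reduced base change to an algebraic closure is separable. -/
theorem Algebra.IsSeparable.of_isReduced_tensorProduct (E A K : Type*) [Field E] [Field A]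
    [Field K] [IsAlgClosed K] [Algebra E A] [Algebra E K] [Algebra.IsAlgebraic E A]
    [IsReduced (K ⊗[E] A)] : Algebra.IsSeparable E A := by
  refine ⟨fun a ↦ ?_⟩
  have ha : IsIntegral E a := Algebra.IsIntegral.isIntegral a
  have : IsReduced (K ⊗[E] E⟮a⟯) :=
    isReduced_of_injective (Algebra.TensorProduct.map (AlgHom.id E K) E⟮a⟯.val)
      (Module.Flat.lTensor_preserves_injective_linearMap E⟮a⟯.val.toLinearMap E⟮a⟯.val.injective)
  have h := (IntermediateField.adjoin.powerBasis ha).isSeparable_gen_of_isReduced_tensorProduct K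
  rw [IntermediateField.adjoin.powerBasis_gen] at h
  have h1 := minpoly_gen E a
  rwa [_root_.IsSeparable, h1] at h

open Polynomial in
/-- If `A` is a separable algebraic extension of `E`, then `K ⊗[A] F` is reduced as soon as
`K ⊗[E] F` is. -/
theorem isReduced_tensorProduct_of_isSeparable_s15 (E A K F : Type*) [Field E] [Field A] [CommRing K]
    [CommRing F] [Algebra E A] [Algebra.IsSeparable E A] [Algebra A K] [Algebra A F]
    [Algebra E K] [Algebra E F] [IsScalarTower E A K] [IsScalarTower E A F]
    [IsReduced (K ⊗[E] F)] : IsReduced (K ⊗[A] F) := by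
  let π : K ⊗[E] F →ₐ[A] K ⊗[A] F := Algebra.TensorProduct.mapOfCompatibleSMul A E A K F
  have hπ : Function.Surjective π := Algebra.TensorProduct.mapOfCompatibleSMul_surjective A E A K F
  have key (v : K ⊗[E] F) (hv : π v = 0) : ∃ e, e * v = 0 ∧ IsUnit (π e) := by
    have hv' : v ∈ (TensorProduct.mapOfCompatibleSMul A E A K F).ker := hv
    rw [TensorProduct.AlgebraTensorModule.ker_mapOfCompatibleSMul] at hv'
    induction hv' using Submodule.span_induction with
    | zero => exact ⟨1, by simp⟩
    | add x y hx hy hx' hy' =>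
      rw [← TensorProduct.AlgebraTensorModule.ker_mapOfCompatibleSMul] at hx hy
      obtain ⟨e, he, heu⟩ := hx' hx
      obtain ⟨f, hf, hfu⟩ := hy' hy
      refine ⟨e * f, ?_, by rw [map_mul]; exact heu.mul hfu⟩
      linear_combination f * he + e * hf
    | smul a x hx hx' =>
      rw [← TensorProduct.AlgebraTensorModule.ker_mapOfCompatibleSMul] at hx
      obtain ⟨e, he, heu⟩ := hx' hx
      exact ⟨e, by rw [mul_smul_comm, he, smul_zero], heu⟩
    | mem x hx =>
      obtain ⟨a, m, n, rfl⟩ := hx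
      have hroot : ((minpoly E a).map (algebraMap E A)).IsRoot a := by simp [IsRoot]
      obtain ⟨h, hh⟩ := dvd_iff_isRoot.mpr hroot
      have hsep := Separable.map (f := algebraMap E A) (Algebra.IsSeparable.isSeparable E a)
      have hha : eval a h ≠ 0 := by
        intro h0
        refine hsep.eval₂_derivative_ne_zero (RingHom.id A) hroot ?_
        rw [hh]
        simp [eval₂_id, h0]
      refine ⟨aeval ((1 : K) ⊗ₜ[E] algebraMap A F a) h, ?_, ?_⟩
      · have h1 := congrArg (aeval ((1 : K) ⊗ₜ[E] algebraMap A F a)) hh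
        have h2 : aeval ((1 : K) ⊗ₜ[E] algebraMap A F a) ((minpoly E a).map (algebraMap E A)) = 0 := by
          rw [aeval_map_algebraMap]
          have : (1 : K) ⊗ₜ[E] algebraMap A F a =
            ((Algebra.TensorProduct.includeRight : F →ₐ[E] K ⊗[E] F).comp (IsScalarTower.toAlgHom E A F)) a := rfl
          rw [this, aeval_algHom_apply, minpoly.aeval, map_zero]
        rw [h2] at h1
        have h3 : (a • m) ⊗ₜ[E] n - m ⊗ₜ[E] (a • n) =
          - (m ⊗ₜ[E] n) * aeval ((1 : K) ⊗ₜ[E] algebraMap A F a) (X - C a) := by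
          simp [mul_sub, Algebra.smul_def, Algebra.TensorProduct.algebraMap_apply, mul_comm]
          abel
        rw [h3]
        rw [map_mul] at h1
        linear_combination m ⊗ₜ[E] n * h1
      · have : π (aeval ((1 : K) ⊗ₜ[E] algebraMap A F a) h) = algebraMap A _ (eval a h) := by
          rw [← aeval_algHom_apply, ← aeval_algebraMap_apply_eq_algebraMap_eval]
          simp [π, Algebra.algebraMap_eq_smul_one, Algebra.TensorProduct.one_def]
        rw [this]
        exact (IsUnit.mk0 _ hha).map _
  refine (isReduced_iff_pow_one_lt 2 one_lt_two).2 fun z hz ↦ ?_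
  obtain ⟨w, rfl⟩ := hπ z
  obtain ⟨e, he, heu⟩ := key (w ^ 2) (by rw [map_pow, hz])
  have h1 : e * w = 0 := by
    refine IsReduced.eq_zero _ ⟨2, ?_⟩
    linear_combination e * he
  have h2 := congrArg π h1
  rw [map_mul, map_zero] at h2
  exact heu.mul_right_eq_zero.mp h2

open Polynomial in
theorem Irreducible.map_of_isIntegrallyClosedIn {A F : Type*} [Field A] [Field F] [Algebra A F]
    [IsIntegrallyClosedIn A F] {f : A[X]} (hf : Irreducible f) (hm : f.Monic) :
    Irreducible (f.map (algebraMap A F)) := by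
  have lift (g : F[X]) (hg : g.Monic) (hd : g ∣ f.map (algebraMap A F)) :
      ∃ g' : A[X], g'.map (algebraMap A F) = g ∧ g'.Monic := by
    have h1 := integralClosure.mem_lifts_of_monic_of_dvd_map F hm hg hd
    rw [lifts_iff_coeff_lifts] at h1
    have h2 : g ∈ lifts (algebraMap A F) := by
      rw [lifts_iff_coeff_lifts]
      intro n
      obtain ⟨c, hc⟩ := h1 n
      obtain ⟨d, hd⟩ := IsIntegrallyClosedIn.algebraMap_eq_of_integral (R := A) c.2
      exact ⟨d, hd.trans hc⟩
    obtain ⟨g', rfl⟩ := (mem_lifts _).mp h2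
    exact ⟨g', rfl, monic_of_injective (algebraMap A F).injective hg⟩
  rw [(hm.map _).irreducible_iff_natDegree]
  refine ⟨fun h ↦ hf.not_isUnit ?_, fun g h hg hh hgh ↦ ?_⟩
  · rw [map_injective _ (algebraMap A F).injective (h.trans (Polynomial.map_one _).symm)]
    exact isUnit_one
  · obtain ⟨g, rfl, hg'⟩ := lift g hg ⟨h, hgh.symm⟩
    obtain ⟨h, rfl, hh'⟩ := lift h hh (Dvd.intro_left _ hgh)
    rw [← Polynomial.map_mul] at hgh
    rw [natDegree_map, natDegree_map]
    exact (hm.irreducible_iff_natDegree.mp hf).2 g h hg' hh'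
      (map_injective _ (algebraMap A F).injective hgh)

open Polynomial in
theorem isDomain_tensorProduct_of_finiteDimensional (A M F : Type*) [Field A] [Field M] [Field F]
    [Algebra A M] [Algebra A F] [FiniteDimensional A M] [Algebra.IsSeparable A M]
    [IsIntegrallyClosedIn A F] : IsDomain (M ⊗[A] F) := by
  let pb := Field.powerBasisOfFiniteOfSeparable A M
  suffices h : IsDomain (F ⊗[A] M) from (Algebra.TensorProduct.comm A M F).toMulEquiv.isDomain
  let φ : F[X] →+* F ⊗[A] M := (aeval ((1 : F) ⊗ₜ[A] pb.gen)).toRingHom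
  have hint : IsIntegral A pb.gen := Algebra.IsIntegral.isIntegral _
  have hφ : Function.Surjective φ := by
    intro z
    induction z with
    | zero => exact ⟨0, map_zero φ⟩
    | add x y hx hy =>
      obtain ⟨p, rfl⟩ := hx
      obtain ⟨q, rfl⟩ := hy
      exact ⟨p + q, map_add φ p q⟩
    | tmul b m =>
      obtain ⟨p, rfl⟩ := pb.exists_eq_aeval' m
      refine ⟨C b * p.map (algebraMap A F), ?_⟩
      change aeval ((1 : F) ⊗ₜ[A] pb.gen) _ = _
      rw [map_mul, aeval_one_tmul_map]
      simp
  have hmax := PrincipalIdealRing.isMaximal_of_irreducible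
    ((minpoly.irreducible hint).map_of_isIntegrallyClosedIn (F := F) (minpoly.monic hint))
  have hker : RingHom.ker φ = Ideal.span {(minpoly A pb.gen).map (algebraMap A F)} := by
    refine (hmax.eq_of_le (RingHom.ker_ne_top _) ?_).symm
    rw [Ideal.span_singleton_le_iff_mem, RingHom.mem_ker]
    change aeval ((1 : F) ⊗ₜ[A] pb.gen) _ = _
    rw [aeval_one_tmul_map, minpoly.aeval, TensorProduct.tmul_zero]
  have : (RingHom.ker φ).IsPrime := hker ▸ hmax.isPrime
  exact (RingHom.quotientKerEquivOfSurjective hφ).symm.toMulEquiv.isDomain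

theorem mem_range_map_of_le {A S F : Type*} [Field A] [Field S] [CommRing F]
    [Algebra A S] [Algebra A F] {M N : IntermediateField A S} (h : M ≤ N) {z : S ⊗[A] F}
    (hz : z ∈ (Algebra.TensorProduct.map M.val (AlgHom.id A F)).range) :
    z ∈ (Algebra.TensorProduct.map N.val (AlgHom.id A F)).range := by
  obtain ⟨x, rfl⟩ := hz
  refine ⟨Algebra.TensorProduct.map (IntermediateField.inclusion h) (AlgHom.id A F) x, ?_⟩
  induction x with
  | zero => simp
  | add x y hx hy => simp_all
  | tmul a b => rfl

theorem exists_finiteDimensional_mem_range_map (A S F : Type*) [Field A] [Field S] [CommRing F]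
    [Algebra A S] [Algebra A F] [Algebra.IsAlgebraic A S] (z : S ⊗[A] F) :
    ∃ M : IntermediateField A S, FiniteDimensional A M ∧
      z ∈ (Algebra.TensorProduct.map M.val (AlgHom.id A F)).range := by
  induction z with
  | zero => exact ⟨⊥, inferInstance, zero_mem _⟩
  | add x y hx hy =>
    obtain ⟨M, hM, hx⟩ := hx
    obtain ⟨N, hN, hy⟩ := hy
    exact ⟨M ⊔ N, IntermediateField.finiteDimensional_sup M N,
      add_mem (mem_range_map_of_le le_sup_left hx) (mem_range_map_of_le le_sup_right hy)⟩
  | tmul s b =>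
    exact ⟨IntermediateField.adjoin A {s}, IntermediateField.adjoin.finiteDimensional
      (Algebra.IsIntegral.isIntegral s), IntermediateField.AdjoinSimple.gen A s ⊗ₜ b, by simp⟩

/-- A field which is relatively algebraically closed in `F` has integral base change of `F` along
separable extensions. -/
theorem isDomain_tensorProduct_of_isSeparable (A S F : Type*) [Field A] [Field S] [Field F]
    [Algebra A S] [Algebra A F] [Algebra.IsSeparable A S] [IsIntegrallyClosedIn A F] :
    IsDomain (S ⊗[A] F) := by
  rw [isDomain_iff_noZeroDivisors_and_nontrivial]
  refine ⟨⟨fun {z w} hzw ↦ ?_⟩, inferInstance⟩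
  obtain ⟨M, hM, hz⟩ := exists_finiteDimensional_mem_range_map A S F z
  obtain ⟨N, hN, hw⟩ := exists_finiteDimensional_mem_range_map A S F w
  have := IntermediateField.finiteDimensional_sup M N
  obtain ⟨z, rfl⟩ := mem_range_map_of_le (le_sup_left : M ≤ M ⊔ N) hz
  obtain ⟨w, rfl⟩ := mem_range_map_of_le (le_sup_right : N ≤ M ⊔ N) hw
  have hinj : Function.Injective
      (Algebra.TensorProduct.map (M ⊔ N).val (AlgHom.id A F)).toRingHom :=
    Module.Flat.rTensor_preserves_injective_linearMap (M ⊔ N).val.toLinearMap (M ⊔ N).val.injective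
  have := isDomain_tensorProduct_of_finiteDimensional A (M ⊔ N : IntermediateField A S) F
  have h : z * w = 0 := hinj (by rw [map_mul, map_zero]; exact hzw)
  rcases mul_eq_zero.mp h with rfl | rfl
  · exact .inl (map_zero _)
  · exact .inr (map_zero _)

theorem exists_pow_mem_range_map_separableClosure (A K F : Type*) [Field A] [Field K] [Field F]
    [Algebra A K] [Algebra A F] [Algebra.IsAlgebraic A K] (q : ℕ) [ExpChar A q] (z : K ⊗[A] F) :
    ∃ n : ℕ, z ^ q ^ n ∈
      (Algebra.TensorProduct.map (separableClosure A K).val (AlgHom.id A F)).range := by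
  have : ExpChar (K ⊗[A] F) q := expChar_of_injective_ringHom (algebraMap A _).injective q
  have : ExpChar (separableClosure A K) q :=
    expChar_of_injective_ringHom (algebraMap A _).injective q
  induction z with
  | zero => exact ⟨0, by simp⟩
  | add x y hx hy =>
    obtain ⟨m, hm⟩ := hx
    obtain ⟨n, hn⟩ := hy
    refine ⟨m + n, ?_⟩
    rw [add_pow_expChar_pow, pow_add, pow_mul, mul_comm (q ^ m), pow_mul]
    exact add_mem (pow_mem hm _) (pow_mem hn _)
  | tmul a b =>
    obtain ⟨n, s, hs⟩ := IsPurelyInseparable.pow_mem (separableClosure A K) q a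
    exact ⟨n, s ⊗ₜ (b ^ q ^ n), by simpa using congrArg (· ⊗ₜ[A] (b ^ q ^ n)) hs⟩

/-- If `A` is relatively algebraically closed in `F` then the base change of `F` to an algebraic
extension of `A` is a domain as soon as it is reduced. -/
theorem isDomain_tensorProduct_of_isReduced (A K F : Type*) [Field A] [Field K] [Field F]
    [Algebra A K] [Algebra A F] [Algebra.IsAlgebraic A K] [IsIntegrallyClosedIn A F]
    [IsReduced (K ⊗[A] F)] : IsDomain (K ⊗[A] F) := by
  rw [isDomain_iff_noZeroDivisors_and_nontrivial]
  refine ⟨⟨fun {z w} hzw ↦ ?_⟩, inferInstance⟩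
  obtain ⟨m, x, hx⟩ := exists_pow_mem_range_map_separableClosure A K F (ringExpChar A) z
  obtain ⟨n, y, hy⟩ := exists_pow_mem_range_map_separableClosure A K F (ringExpChar A) w
  have hinj : Function.Injective
      (Algebra.TensorProduct.map (separableClosure A K).val (AlgHom.id A F)).toRingHom :=
    Module.Flat.rTensor_preserves_injective_linearMap (separableClosure A K).val.toLinearMap
      (separableClosure A K).val.injective
  have := isDomain_tensorProduct_of_isSeparable A (separableClosure A K) F
  have hpos (n : ℕ) : ringExpChar A ^ n ≠ 0 := pow_ne_zero _ (expChar_pos A _).ne'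
  have h : x * y = 0 := hinj <| by
    rw [map_mul, map_zero]
    refine (congrArg₂ (· * ·) hx hy).trans ?_
    obtain ⟨i, hi⟩ := Nat.exists_eq_succ_of_ne_zero (hpos m)
    obtain ⟨j, hj⟩ := Nat.exists_eq_succ_of_ne_zero (hpos n)
    simp only [hi, hj, pow_succ]
    linear_combination z ^ i * w ^ j * hzw
  rcases mul_eq_zero.mp h with rfl | rfl
  · exact .inl (eq_zero_of_pow_eq_zero (hx.symm.trans (map_zero _)))
  · exact .inr (eq_zero_of_pow_eq_zero (hy.symm.trans (map_zero _)))

open MvPolynomial in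
theorem isPrime_map_ker_aeval {A K F τ : Type*} [Field A] [Field K] [Field F] [Algebra A K]
    [Algebra A F] [IsDomain (K ⊗[A] F)] (x : τ → F) :
    ((RingHom.ker (aeval x : MvPolynomial τ A →ₐ[A] F)).map
      (map (σ := τ) (algebraMap A K))).IsPrime := by
  let f : MvPolynomial τ A →ₐ[A] F := aeval x
  let g : K ⊗[A] MvPolynomial τ A →ₐ[A] K ⊗[A] F := Algebra.TensorProduct.map (AlgHom.id A K) f
  have hg : RingHom.ker g = (RingHom.ker f).map
      (Algebra.TensorProduct.includeRight : MvPolynomial τ A →ₐ[A] K ⊗[A] MvPolynomial τ A) := by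
    have h1 := Algebra.TensorProduct.lTensor_ker (A := K) _ f.rangeRestrict_surjective
    rw [AlgHom.ker_rangeRestrict] at h1
    rw [← h1]
    have h2 : g = (Algebra.TensorProduct.map (AlgHom.id A K) f.range.val).comp
        (Algebra.TensorProduct.map (AlgHom.id A K) f.rangeRestrict) := by ext <;> rfl
    have h3 : Function.Injective (Algebra.TensorProduct.map (AlgHom.id A K) f.range.val) :=
      Module.Flat.lTensor_preserves_injective_linearMap f.range.val.toLinearMap
        Subtype.val_injective
    ext z
    rw [RingHom.mem_ker, RingHom.mem_ker, h2, AlgHom.comp_apply, map_eq_zero_iff _ h3]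
  have hp : (RingHom.ker g).IsPrime := RingHom.ker_isPrime g
  rw [hg] at hp
  convert @Ideal.map_isPrime_of_equiv _ _ _ _ _ _ _ (algebraTensorAlgEquiv (σ := τ) A K) _ hp
  exact (map_map_eq_map fun p ↦ by simp).symm

theorem isIntegrallyClosedIn_algebraicClosure (E F : Type*) [Field E] [Field F] [Algebra E F] :
    IsIntegrallyClosedIn (algebraicClosure E F) F := by
  rw [isIntegrallyClosedIn_iff]
  exact ⟨(algebraMap (algebraicClosure E F) F).injective, fun {x} hx ↦
    ⟨⟨x, isIntegral_trans (R := E) (A := algebraicClosure E F) x hx⟩, rfl⟩⟩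

open MvPolynomial in
/-- The existence of points over separable algebraic extensions of PAC fields. -/
theorem IsPAC.exists_eval_eq_zero_of_isAlgebraic {E A τ : Type*} [Field E] [Field A] [Algebra E A]
    [Algebra.IsSeparable E A] [Finite τ] (hE : IsPAC E) (I : Ideal (MvPolynomial τ A))
    (hI : ∀ σ : A →ₐ[E] AlgebraicClosure E,
      (I.map (map (σ := τ) (σ : A →+* AlgebraicClosure E))).IsPrime) :
    ∃ x : τ → A, ∀ p ∈ I, eval x p = 0 := by
  classical
  obtain ⟨s, rfl⟩ := (isNoetherianRing_iff_ideal_fg _).mp inferInstance I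
  let c : Finset A := s.biUnion fun p ↦ p.coeffs
  let L : IntermediateField E A := IntermediateField.adjoin E (c : Set A)
  have : FiniteDimensional E L := IntermediateField.finiteDimensional_adjoin
    fun x _ ↦ Algebra.IsIntegral.isIntegral x
  let t : Set (MvPolynomial τ L) := map (algebraMap L A) ⁻¹' s
  have ht : map (algebraMap L A) '' t = s := by
    refine Set.image_preimage_eq_of_subset fun p hp ↦ ?_
    rw [mem_range_map_iff_coeffs_subset]
    exact fun a ha ↦ ⟨⟨a, IntermediateField.subset_adjoin E _
      (Finset.mem_biUnion.mpr ⟨p, hp, ha⟩)⟩, rfl⟩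
  obtain ⟨x, hx⟩ := hE.exists_eval_eq_zero_of_isSeparable t fun σ ↦ by
    obtain ⟨σ', rfl⟩ := IsAlgClosed.surjective_domRestrict_of_isAlgebraic (E := A) σ
    have h := hI σ'
    rw [Ideal.map_span, ← ht, Set.image_image] at h
    simp_rw [map_map] at h
    exact h
  refine ⟨fun i ↦ x i, fun p hp ↦ ?_⟩
  have hle : Ideal.span (s : Set (MvPolynomial τ A)) ≤ RingHom.ker (eval fun i ↦ (x i : A)) := by
    rw [Ideal.span_le, ← ht]
    rintro _ ⟨q, hq, rfl⟩
    rw [SetLike.mem_coe, RingHom.mem_ker, eval_map]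
    have := congrArg (algebraMap L A) (hx q hq)
    rw [eval₂_comp, map_zero] at this
    exact this
  exact hle hp

/-- If `F/E` is a separable extension with `E` PAC, then the relative algebraic closure of `E`
in `F` is existentially closed in `F`. -/
theorem stmt_15 (E F : Type*) [Field E] [Field F] [Algebra E F]
    (hsep : IsSeparableFieldExt E F) (hPAC : IsPAC E) :
    ExistClosedAlong (algebraicClosure E F).val.toRingHom := by
  let K := AlgebraicClosure E
  let A := algebraicClosure E F
  have hred : IsReduced (K ⊗[E] F) := hsep
  have : IsReduced (K ⊗[E] A) :=
    isReduced_of_injective (Algebra.TensorProduct.map (AlgHom.id E K) A.val)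
      (Module.Flat.lTensor_preserves_injective_linearMap A.val.toLinearMap A.val.injective)
  have : Algebra.IsSeparable E A := .of_isReduced_tensorProduct E A K
  have := isIntegrallyClosedIn_algebraicClosure E F
  rintro n S T ⟨x, hS, hT⟩
  let y : Option (Fin n) → F := fun i ↦ i.elim (∏ q ∈ T, MvPolynomial.aeval x q)⁻¹ x
  obtain ⟨z, hz⟩ := hPAC.exists_eval_eq_zero_of_isAlgebraic
    (RingHom.ker (MvPolynomial.aeval y : MvPolynomial (Option (Fin n)) A →ₐ[A] F)) fun σ ↦ by
      let := σ.toRingHom.toAlgebra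
      have : IsScalarTower E A K := .of_algebraMap_eq fun e ↦ (σ.commutes e).symm
      have : Algebra.IsAlgebraic A K := .tower_top (K := E) A
      have : IsReduced (K ⊗[A] F) := isReduced_tensorProduct_of_isSeparable_s15 E A K F
      have : IsDomain (K ⊗[A] F) := isDomain_tensorProduct_of_isReduced A K F
      exact isPrime_map_ker_aeval (K := K) y
  have hy (q : MvPolynomial (Fin n) A) :
      MvPolynomial.aeval y (MvPolynomial.rename some q) = MvPolynomial.aeval x q := by
    rw [MvPolynomial.aeval_rename]
    rfl
  refine ⟨fun i ↦ z (some i), fun q hq ↦ ?_, fun q hq h0 ↦ ?_⟩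
  · have h := hz (MvPolynomial.rename some q) (by
      rw [RingHom.mem_ker, hy]
      exact hS q hq)
    rwa [MvPolynomial.eval_rename] at h
  · have h := hz (MvPolynomial.X none * ∏ q ∈ T, MvPolynomial.rename some q - 1) (by
      rw [RingHom.mem_ker, map_sub, map_mul, map_one, MvPolynomial.aeval_X, map_prod]
      simp_rw [hy]
      rw [sub_eq_zero]
      exact inv_mul_cancel₀ (Finset.prod_ne_zero_iff.mpr hT))
    rw [map_sub, map_mul, map_one, map_prod, Finset.prod_eq_zero hq, mul_zero, zero_sub,
      neg_eq_zero] at h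
    · exact one_ne_zero h
    · rwa [MvPolynomial.eval_rename]
end
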